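/- For every integer j ≥ 245 and every positive integer m, the number m + j is the sum of exactly j positive seventh powers if and only if m + 245 is the sum of exactly 245 positive seventh powers. -/

import Mathlib

/-- A positive integer `n` is `(j,k)`-representable if it is a sum of exactly `j`
positive `k`-th powers. -/
def IsRepr (n j k : ℕ) : Prop :=
  ∃ a : Fin j → ℕ, (∀ i, 0 < a i) ∧ ∑ i, (a i) ^ k = n


theorem IsRepr.add {m n i j k : ℕ} (hm : IsRepr m i k) (hn : IsRepr n j k) :
    IsRepr (m + n) (i + j) k := by
  obtain ⟨a, ha, rfl⟩ := hm
  obtain ⟨b, hb, rfl⟩ := hn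
  refine ⟨Fin.append a b, fun x => ?_, by simp [Fin.sum_univ_add]⟩
  refine Fin.addCases (fun x => ?_) (fun x => ?_) x
  · simpa using ha x
  · simpa using hb x

theorem isRepr_pow {x : ℕ} (hx : 0 < x) (k : ℕ) : IsRepr (x ^ k) 1 k :=
  ⟨fun _ => x, fun _ => hx, by simp⟩

theorem isRepr_zero (k : ℕ) : IsRepr 0 0 k := ⟨fun _ => 1, fun _ => one_pos, by simp⟩

theorem isRepr_self (j k : ℕ) : IsRepr j j k := ⟨fun _ => 1, fun _ => one_pos, by simp⟩

theorem IsRepr.pow_mul {n j k : ℕ} (h : IsRepr n j k) {y : ℕ} (hy : 0 < y) :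
    IsRepr (y ^ k * n) j k := by
  obtain ⟨a, ha, rfl⟩ := h
  exact ⟨fun i => y * a i, fun i => Nat.mul_pos hy (ha i), by simp [mul_pow, Finset.mul_sum]⟩

theorem IsRepr.exists_of_succ {n j k : ℕ} (h : IsRepr n (j + 1) k) :
    ∃ x r : ℕ, 0 < x ∧ IsRepr r j k ∧ n = r + x ^ k := by
  obtain ⟨a, ha, rfl⟩ := h
  exact ⟨a (Fin.last j), _, ha _, ⟨fun i => a i.castSucc, fun i => ha _, rfl⟩,
    Fin.sum_univ_castSucc _⟩

theorem IsRepr.le {n j k : ℕ} (h : IsRepr n j k) : j ≤ n := by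
  obtain ⟨a, ha, rfl⟩ := h
  simpa using Finset.card_nsmul_le_sum Finset.univ (fun i => a i ^ k) 1
    fun i _ => Nat.one_le_pow _ _ (ha i)

/-- `m` is a sum of at most `s` numbers of the form `x ^ 7 - 1`. -/
def Reach (s m : ℕ) : Prop := IsRepr (m + s) s 7

theorem Reach.mono {s t m : ℕ} (h : Reach s m) (hst : s ≤ t) : Reach t m := by
  have := IsRepr.add h (isRepr_self (t - s) 7)
  rwa [add_assoc, Nat.add_sub_cancel' hst] at this

theorem Reach.add {s t m n : ℕ} (hm : Reach s m) (hn : Reach t n) : Reach (s + t) (m + n) := by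
  have := IsRepr.add hm hn
  rwa [show m + s + (n + t) = m + n + (s + t) by ring] at this

theorem reach_pow_sub_one {x : ℕ} (hx : 0 < x) : Reach 1 (x ^ 7 - 1) := by
  have := isRepr_pow hx 7
  rwa [Reach, Nat.sub_add_cancel (Nat.one_le_pow _ _ hx)]

/-- All integers of the interval `[l, l + d]` are sums of at most `s` numbers `x ^ 7 - 1`. -/
def ReachInterval (s l d : ℕ) : Prop := ∀ m, l ≤ m → m ≤ l + d → Reach s m

theorem ReachInterval.mono {s t l d d' : ℕ} (h : ReachInterval s l d) (hst : s ≤ t)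
    (hd : d' ≤ d) : ReachInterval t l d' :=
  fun m h1 h2 => (h m h1 (by omega)).mono hst

theorem pow_seven_gap_mono {x y : ℕ} (h : x ≤ y) :
    (x + 1) ^ 7 - x ^ 7 ≤ (y + 1) ^ 7 - y ^ 7 := by
  have key : ∀ z : ℕ, (z + 1) ^ 7 - z ^ 7 =
      7 * z ^ 6 + 21 * z ^ 5 + 35 * z ^ 4 + 35 * z ^ 3 + 21 * z ^ 2 + 7 * z + 1 := by
    intro z
    rw [Nat.sub_eq_iff_eq_add (Nat.pow_le_pow_left (Nat.le_add_right z 1) 7)]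
    ring
  rw [key, key]
  gcongr

theorem ReachInterval.extend {s l d x : ℕ} (h : ReachInterval s l d)
    (hx : (x + 1) ^ 7 - x ^ 7 ≤ d + 1) :
    ReachInterval (s + 1) l (d + ((x + 1) ^ 7 - 1)) := by
  intro m h1 h2
  have hpos : 1 ≤ (x + 1) ^ 7 := Nat.one_le_pow _ _ (Nat.succ_pos x)
  suffices ∃ y, 0 < y ∧ l ≤ m - (y ^ 7 - 1) ∧ m - (y ^ 7 - 1) ≤ l + d ∧ y ^ 7 - 1 ≤ m by
    obtain ⟨y, hy, hl, hr, hm⟩ := this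
    simpa [Nat.sub_add_cancel hm] using (h _ hl hr).add (reach_pow_sub_one hy)
  by_cases hbig : l + ((x + 1) ^ 7 - 1) ≤ m
  · exact ⟨x + 1, Nat.succ_pos x, by omega, by omega, by omega⟩
  push Not at hbig
  have hex : ∃ y, m < l + ((y + 1) ^ 7 - 1) := ⟨x, hbig⟩
  classical
  let y := Nat.find hex
  have hy : m < l + ((y + 1) ^ 7 - 1) := Nat.find_spec hex
  have hyx : y ≤ x := Nat.find_min' hex hbig
  have hy0 : 0 < y := by
    rcases Nat.eq_zero_or_pos y with h0 | h0
    · rw [h0] at hy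
      omega
    · exact h0
  have hmin : ¬ m < l + ((y - 1 + 1) ^ 7 - 1) := Nat.find_min hex (Nat.sub_lt hy0 one_pos)
  rw [Nat.sub_add_cancel hy0] at hmin
  have hgap := pow_seven_gap_mono hyx
  have h1y : 1 ≤ y ^ 7 := Nat.one_le_pow _ _ hy0
  exact ⟨y, hy0, by omega, by omega, by omega⟩

/-- A number `x`, found bit by bit among those below `2 ^ k + x₀`, with
`(x + 1) ^ 7 - x ^ 7 ≤ d + 1`. -/
def gapRoot (d : ℕ) : ℕ → ℕ → ℕ
  | 0, x => x
  | k + 1, x =>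
    if (x + 2 ^ k + 1) ^ 7 - (x + 2 ^ k) ^ 7 ≤ d + 1 then gapRoot d k (x + 2 ^ k)
    else gapRoot d k x

theorem gapRoot_spec (d k x : ℕ) (hx : (x + 1) ^ 7 - x ^ 7 ≤ d + 1) :
    (gapRoot d k x + 1) ^ 7 - gapRoot d k x ^ 7 ≤ d + 1 := by
  induction k generalizing x with
  | zero => exact hx
  | succ k ih =>
    unfold gapRoot
    split_ifs with h
    · exact ih _ h
    · exact ih _ hx

/-- The length of the interval reached from one of length `d` by `j` further summands. -/
def grow (k : ℕ) : ℕ → ℕ → ℕ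
  | 0, d => d
  | j + 1, d => grow k j (d + ((gapRoot d k 0 + 1) ^ 7 - 1))

theorem ReachInterval.grow {s l d : ℕ} (h : ReachInterval s l d) (k j : ℕ) :
    ReachInterval (s + j) l (grow k j d) := by
  induction j generalizing s d with
  | zero => exact h
  | succ j ih =>
    have := ih (h.extend (gapRoot_spec d k 0 (by simp)))
    rwa [add_assoc, add_comm 1 j] at this

theorem ReachInterval.extend_two_pow {s l e : ℕ} (h : ReachInterval s l (2 ^ e)) (he : 3 ≤ e) :
    ReachInterval (s + 1) l (2 ^ (7 * ((e - 3) / 6))) := by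
  set k := (e - 3) / 6 with hk
  have hke : 6 * k + 3 ≤ e := by omega
  have hpos : 1 ≤ 2 ^ k := Nat.one_le_two_pow
  obtain ⟨x, hx⟩ : ∃ x, 2 ^ k = x + 1 := ⟨2 ^ k - 1, by omega⟩
  have h1 : (x + 1) ^ 7 ≤ x ^ 7 + 8 * (x + 1) ^ 6 := by
    have hb : (x + 1) ^ 7 - x ^ 7 ≤ 7 * (x + 1) ^ 6 := by
      rw [Nat.sub_le_iff_le_add]
      nlinarith [sq_nonneg (x : ℤ), Nat.zero_le (x ^ 6), Nat.zero_le (x ^ 5), Nat.zero_le (x ^ 4),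
        Nat.zero_le (x ^ 3), Nat.zero_le (x ^ 2), Nat.zero_le x]
    omega
  have h2 : 8 * (x + 1) ^ 6 ≤ 2 ^ e := by
    rw [← hx, ← pow_mul, show (8 : ℕ) = 2 ^ 3 by norm_num, ← pow_add]
    exact Nat.pow_le_pow_right two_pos (by omega)
  refine (h.extend (x := x) (by omega)).mono le_rfl ?_
  rw [mul_comm 7, pow_mul, hx]
  have : 1 ≤ 2 ^ e := Nat.one_le_two_pow
  omega

/-- The exponent reached from `e` after `j` steps of `ReachInterval.extend_two_pow`. -/
def growExp : ℕ → ℕ → ℕ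
  | 0, e => e
  | j + 1, e => growExp j (7 * ((e - 3) / 6))

theorem ReachInterval.growExp {s l e : ℕ} (h : ReachInterval s l (2 ^ e)) (he : 63 ≤ e) (j : ℕ) :
    ReachInterval (s + j) l (2 ^ growExp j e) := by
  induction j generalizing s e with
  | zero => exact h
  | succ j ih =>
    have := ih (h.extend_two_pow (by omega)) (by omega)
    rwa [add_assoc, add_comm 1 j] at this

/-- The numbers `m < n` with `Reach s m`, as bits of a natural number. -/
def reachBits (n : ℕ) : ℕ → ℕ
  | 0 => 1
  | s + 1 =>
    let b := reachBits n s
    (b ||| (b <<< 127 ||| (b <<< 2186 ||| (b <<< 16383 ||| (b <<< 78124 ||| (b <<< 279935 |||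
      (b <<< 823542 ||| b <<< 2097151))))))) &&& (2 ^ n - 1)

theorem reach_of_testBit_shiftLeft {s b x : ℕ} (hb : ∀ m, b.testBit m → Reach s m) (hx : 0 < x)
    {m : ℕ} (h : (b <<< (x ^ 7 - 1)).testBit m) : Reach (s + 1) m := by
  rw [Nat.testBit_shiftLeft, Bool.and_eq_true, decide_eq_true_eq] at h
  simpa [Nat.sub_add_cancel h.1] using (hb _ h.2).add (reach_pow_sub_one hx)

theorem reach_of_testBit_reachBits (n s : ℕ) : ∀ m, (reachBits n s).testBit m → Reach s m := by
  induction s with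
  | zero =>
    intro m hm
    obtain rfl : m = 0 := by
      simpa [reachBits, Nat.testBit_one_eq_true_iff_self_eq_zero] using hm
    exact isRepr_zero 7
  | succ s ih =>
    intro m hm
    have key := fun x hx => @reach_of_testBit_shiftLeft s _ x ih hx m
    simp only [reachBits, Nat.testBit_and, Nat.testBit_or, Bool.and_eq_true, Bool.or_eq_true] at hm
    rcases hm.1 with h | h | h | h | h | h | h | h
    · exact (ih m h).mono (Nat.le_succ s)
    · exact key 2 (by norm_num) h
    · exact key 3 (by norm_num) h
    · exact key 4 (by norm_num) h
    · exact key 5 (by norm_num) h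
    · exact key 6 (by norm_num) h
    · exact key 7 (by norm_num) h
    · exact key 8 (by norm_num) h

theorem reachInterval_of_bits {n s l d : ℕ}
    (h : (reachBits n s >>> l) % 2 ^ (d + 1) = 2 ^ (d + 1) - 1) : ReachInterval s l d := by
  intro m h1 h2
  apply reach_of_testBit_reachBits n
  have := congrArg (fun b => b.testBit (m - l)) h
  simp only [Nat.testBit_mod_two_pow, Nat.testBit_two_pow_sub_one, Nat.testBit_shiftRight,
    show m - l < d + 1 by omega, decide_true, Bool.true_and, Nat.add_sub_cancel' h1] at this
  exact this

theorem reachInterval_base : ReachInterval 72 1872394 1280000 :=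
  reachInterval_of_bits (n := 3160000) (by decide +kernel)

theorem reachInterval_109 : ReachInterval 109 1872394 (2 ^ 1071) :=
  (reachInterval_base.grow 160 37).mono le_rfl (by decide +kernel)

theorem reachInterval_245 : ∃ e, 379010 ≤ e ∧ ReachInterval 245 1872394 (2 ^ e) :=
  ⟨_, by decide +kernel, (reachInterval_109.growExp (by norm_num) 60).mono (by norm_num) le_rfl⟩

/-- Adjoin the translates by `127 * k`. -/
def addTranslate (n k b : ℕ) : ℕ := (b ||| b <<< (127 * k)) &&& (2 ^ n - 1)

theorem reach_of_testBit_addTranslate {n k b s : ℕ} (hb : ∀ m, b.testBit m → Reach s m) :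
    ∀ m, (addTranslate n k b).testBit m → Reach (s + k) m := by
  intro m hm
  have hk : ∀ k, Reach k (127 * k) := by
    intro k
    induction k with
    | zero => exact isRepr_zero 7
    | succ k ih => exact ih.add (reach_pow_sub_one (x := 2) two_pos)
  simp only [addTranslate, Nat.testBit_and, Nat.testBit_or, Bool.and_eq_true, Bool.or_eq_true,
    Nat.testBit_shiftLeft, decide_eq_true_eq] at hm
  rcases hm.1 with h | h
  · exact (hb m h).mono (Nat.le_add_right s k)
  · simpa [Nat.sub_add_cancel h.1] using (hb _ h.2).add (hk k)

/-- The numbers below `1900000` that are sums of at most `245` numbers `x ^ 7 - 1`. -/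
def smallBits : ℕ :=
  [1, 2, 4, 8, 16, 32, 62].foldl (fun b k => addTranslate 1900000 k b) (reachBits 1900000 120)

theorem reach_of_testBit_smallBits : ∀ m, smallBits.testBit m → Reach 245 m := by
  have key : ∀ (n s b : ℕ) (l : List ℕ), (∀ m, b.testBit m → Reach s m) →
      ∀ m, (l.foldl (fun b k => addTranslate n k b) b).testBit m → Reach (s + l.sum) m := by
    intro n s b l hb
    induction l generalizing s b with
    | nil => exact hb
    | cons k l ih =>
      have := ih (s + k) _ (reach_of_testBit_addTranslate (n := n) hb)
      rwa [List.sum_cons, ← add_assoc]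
  exact key 1900000 120 _ _ (reach_of_testBit_reachBits 1900000 120)

/-- One more summand `x ^ 7 - 1`, with `x < 8`, truncated to the numbers below `n`. -/
def adjoin (n b : ℕ) : ℕ :=
  (b ||| b <<< (2 ^ 7 - 1) ||| b <<< (3 ^ 7 - 1) ||| b <<< (4 ^ 7 - 1) ||| b <<< (5 ^ 7 - 1) |||
    b <<< (6 ^ 7 - 1) ||| b <<< (7 ^ 7 - 1)) &&& (2 ^ n - 1)

theorem testBit_add_of_adjoin_eq {n b m x : ℕ} (hn : n ≤ 2097151) (hb : adjoin n b = b)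
    (hm : b.testBit m) (hx : 0 < x) (hlt : m + (x ^ 7 - 1) < n) :
    b.testBit (m + (x ^ 7 - 1)) := by
  have hx8 : x < 8 := by
    by_contra! h
    have := Nat.pow_le_pow_left h 7
    omega
  rw [← hb]
  simp only [adjoin, Nat.testBit_and, Nat.testBit_or, Nat.testBit_two_pow_sub_one,
    Nat.testBit_shiftLeft, hlt, decide_true, Bool.and_true, Bool.or_eq_true, Bool.and_eq_true,
    decide_eq_true_eq]
  interval_cases x <;> simp only [Nat.le_add_left, Nat.add_sub_cancel, hm, one_pow, Nat.sub_self,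
    Nat.add_zero, and_self, true_or, or_true]

/-- `smallBits` is closed under adding the numbers `x ^ 7 - 1`. -/
theorem adjoin_smallBits : adjoin 1900000 smallBits = smallBits := by
  decide +kernel

theorem testBit_smallBits_zero : smallBits.testBit 0 := by
  decide +kernel

theorem testBit_smallBits_of_reach {j m : ℕ} (h : Reach j m) (hm : m < 1900000) :
    smallBits.testBit m := by
  induction j generalizing m with
  | zero =>
    obtain ⟨a, -, ha⟩ := h
    obtain rfl : m = 0 := by simpa using ha.symm
    exact testBit_smallBits_zero
  | succ j ih =>
    obtain ⟨x, r, hx, hr, heq⟩ := IsRepr.exists_of_succ h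
    have hx1 : 1 ≤ x ^ 7 := Nat.one_le_pow _ _ hx
    have hjr := hr.le
    obtain rfl : m = r - j + (x ^ 7 - 1) := by omega
    refine testBit_add_of_adjoin_eq (by norm_num) adjoin_smallBits (ih ?_ (by omega)) hx hm
    rwa [Reach, Nat.sub_add_cancel hjr]

/-- The complete sum of `ζ ^ (x ^ 7)` over the residues modulo `q`. -/
noncomputable def gaussSeven (ζ : ℂ) (q : ℕ) : ℂ := ∑ x ∈ Finset.range q, ζ ^ (x ^ 7)

theorem sum_range_natCast_zmod (q : ℕ) [NeZero q] (F : ZMod q → ℂ) :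
    ∑ x ∈ Finset.range q, F (x : ZMod q) = ∑ x, F x := by
  refine Finset.sum_bij (fun x _ => (x : ZMod q)) (fun _ _ => Finset.mem_univ _) ?_ ?_
    fun _ _ => rfl
  · intro x hx y hy h
    rw [ZMod.natCast_eq_natCast_iff] at h
    exact h.eq_of_lt_of_lt (Finset.mem_range.1 hx) (Finset.mem_range.1 hy)
  · exact fun x _ => ⟨x.val, Finset.mem_range.2 (ZMod.val_lt x), ZMod.natCast_zmod_val x⟩

theorem sum_range_mul_of_periodic {F : ℕ → ℂ} {m : ℕ} (h : ∀ x, F (m + x) = F x) (k : ℕ) :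
    ∑ x ∈ Finset.range (k * m), F x = k * ∑ x ∈ Finset.range m, F x := by
  induction k with
  | zero => simp
  | succ k ih =>
    rw [add_mul, one_mul, add_comm, Finset.sum_range_add]
    simp only [h, ih]
    push_cast
    ring

theorem pow_pow_eq_of_modEq {ζ : ℂ} {q a b : ℕ} (hζ : ζ ^ q = 1) (h : a ≡ b [MOD q]) :
    ζ ^ a = ζ ^ b := by
  rw [pow_eq_pow_mod a hζ, pow_eq_pow_mod b hζ, h]

theorem norm_gaussSeven_le {ζ : ℂ} (hζ : ‖ζ‖ = 1) (q : ℕ) : ‖gaussSeven ζ q‖ ≤ q := by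
  simpa [gaussSeven, hζ] using norm_sum_le (Finset.range q) fun x => ζ ^ (x ^ 7)

theorem gaussSeven_mul {ζ : ℂ} {m n : ℕ} (hm : 0 < m) (hn : 0 < n) (hmn : m.Coprime n)
    (hζ : ζ ^ (m * n) = 1) :
    gaussSeven ζ (m * n) = gaussSeven (ζ ^ n ^ 7) m * gaussSeven (ζ ^ m ^ 7) n := by
  have key : gaussSeven ζ (m * n) =
      ∑ w ∈ Finset.range m ×ˢ Finset.range n, ζ ^ ((n * w.1 + m * w.2) ^ 7) := by
    have hmaps : Set.MapsTo (fun w : ℕ × ℕ => (n * w.1 + m * w.2) % (m * n))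
        ↑(Finset.range m ×ˢ Finset.range n) ↑(Finset.range (m * n)) :=
      fun w _ => Finset.mem_coe.2 (Finset.mem_range.2 (Nat.mod_lt _ (Nat.mul_pos hm hn)))
    have hinj : Set.InjOn (fun w : ℕ × ℕ => (n * w.1 + m * w.2) % (m * n))
        ↑(Finset.range m ×ˢ Finset.range n) := by
      rintro ⟨u, v⟩ h1 ⟨u', v'⟩ h2 h
      simp only [Finset.coe_product, Finset.coe_range, Set.mem_prod, Set.mem_Iio] at h1 h2
      have h' : n * u + m * v ≡ n * u' + m * v' [MOD m * n] := h
      have hu : n * u ≡ n * u' [MOD m] := by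
        simpa [Nat.ModEq, Nat.add_mod, Nat.mul_mod] using h'.of_mul_right n
      have hv : m * v ≡ m * v' [MOD n] := by
        simpa [Nat.ModEq, Nat.add_mod, Nat.mul_mod] using h'.of_mul_left m
      have hu' := (hu.cancel_left_of_coprime hmn).eq_of_lt_of_lt h1.1 h2.1
      have hv' := (hv.cancel_left_of_coprime hmn.symm).eq_of_lt_of_lt h1.2 h2.2
      rw [hu', hv']
    symm
    refine Finset.sum_nbij _ hmaps hinj
      (Finset.surjOn_of_injOn_of_card_le _ hmaps hinj (by simp)) fun w _ => ?_
    exact pow_pow_eq_of_modEq hζ ((Nat.mod_modEq _ _).symm.pow 7)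
  rw [key, Finset.sum_product, gaussSeven, gaussSeven, Finset.sum_mul_sum]
  refine Finset.sum_congr rfl fun u _ => Finset.sum_congr rfl fun v _ => ?_
  rw [← pow_mul, ← pow_mul, ← pow_add]
  refine pow_pow_eq_of_modEq hζ ?_
  have : (n * u + m * v) ^ 7 = n ^ 7 * u ^ 7 + m ^ 7 * v ^ 7 + (m * n) * (u * v *
      (7 * (n * u) ^ 5 + 21 * (n * u) ^ 4 * (m * v) + 35 * (n * u) ^ 3 * (m * v) ^ 2 +
        35 * (n * u) ^ 2 * (m * v) ^ 3 + 21 * (n * u) * (m * v) ^ 4 + 7 * (m * v) ^ 5)) := by ring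
  rw [this]
  simp [Nat.ModEq]
theorem sum_pow_seven_eq_sum_filter {R : Type*} [CommRing R] [Fintype R] [DecidableEq R]
    {ψ : AddChar R ℂ} (hψ : ψ.IsPrimitive) {N c : R}
    (h : ∀ x z, (x + N * z) ^ 7 = x ^ 7 + z * (c * x ^ 6)) :
    ∑ x, ψ (x ^ 7) = ∑ x with c * x ^ 6 = 0, ψ (x ^ 7) := by
  have hcard : (Fintype.card R : ℂ) ≠ 0 := Nat.cast_ne_zero.2 Fintype.card_ne_zero
  refine mul_left_cancel₀ hcard ?_
  calc (Fintype.card R : ℂ) * ∑ x, ψ (x ^ 7) = ∑ z : R, ∑ x, ψ ((x + N * z) ^ 7) := by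
        have : ∀ z : R, ∑ x, ψ ((x + N * z) ^ 7) = ∑ x, ψ (x ^ 7) := fun z =>
          Fintype.sum_equiv (Equiv.addRight (N * z)) _ _ fun x => rfl
        simp [this]
    _ = ∑ x, ψ (x ^ 7) * ∑ z, ψ (z * (c * x ^ 6)) := by
        rw [Finset.sum_comm]
        simp only [h, AddChar.map_add_eq_mul, Finset.mul_sum]
    _ = _ := by
        simp only [AddChar.sum_mulShift _ hψ, Finset.mul_sum, Finset.sum_filter]
        refine Finset.sum_congr rfl fun x _ => ?_
        split_ifs <;> simp [mul_comm]

theorem gaussSeven_eq_sum_zmodChar {ζ : ℂ} {q : ℕ} [NeZero q] (hζ : ζ ^ q = 1) :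
    gaussSeven ζ q = ∑ x, AddChar.zmodChar q hζ (x ^ 7) := by
  rw [← sum_range_natCast_zmod, gaussSeven]
  refine Finset.sum_congr rfl fun x _ => ?_
  rw [← AddChar.zmodChar_apply' hζ, Nat.cast_pow]

/-- If `x ↦ x + N z` changes `x ^ 7` by `c x ^ 6 z` modulo `p ^ l`, and `c x ^ 6` vanishes exactly
for the multiples of `p`, then only these contribute to the complete sum modulo `p ^ l`. -/
theorem gaussSeven_prime_pow_eq_sum {p l N c : ℕ} (hp : p.Prime) {ζ : ℂ}
    (hζ : IsPrimitiveRoot ζ (p ^ (l + 1)))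
    (h : ∀ x z : ZMod (p ^ (l + 1)), (x + N * z) ^ 7 = x ^ 7 + z * (c * x ^ 6))
    (hc : ∀ x : ℕ, p ^ (l + 1) ∣ c * x ^ 6 ↔ p ∣ x) :
    gaussSeven ζ (p ^ (l + 1)) = ∑ y ∈ Finset.range (p ^ l), ζ ^ ((p * y) ^ 7) := by
  have : NeZero (p ^ (l + 1)) := ⟨(pow_pos hp.pos _).ne'⟩
  rw [gaussSeven_eq_sum_zmodChar hζ.pow_eq_one,
    sum_pow_seven_eq_sum_filter (AddChar.zmodChar_primitive_of_primitive_root _ hζ) h,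
    Finset.sum_filter, ← sum_range_natCast_zmod, ← Finset.sum_filter]
  have hset : (Finset.range (p ^ (l + 1))).filter
      (fun x : ℕ => (c : ZMod (p ^ (l + 1))) * (x : ZMod (p ^ (l + 1))) ^ 6 = 0) =
      (Finset.range (p ^ l)).image (fun y => p * y) := by
    ext x
    have : ((c : ZMod (p ^ (l + 1))) * (x : ZMod (p ^ (l + 1))) ^ 6 = 0) ↔ p ∣ x := by
      rw [← hc, ← ZMod.natCast_eq_zero_iff]
      push_cast
      rfl
    simp only [Finset.mem_filter, Finset.mem_range, this, Finset.mem_image]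
    constructor
    · rintro ⟨hx, y, rfl⟩
      rw [pow_succ'] at hx
      exact ⟨y, Nat.lt_of_mul_lt_mul_left hx, rfl⟩
    · rintro ⟨y, hy, rfl⟩
      rw [pow_succ']
      exact ⟨Nat.mul_lt_mul_of_pos_left hy hp.pos, dvd_mul_right p y⟩
  rw [hset, Finset.sum_image fun a _ b _ hab => Nat.eq_of_mul_eq_mul_left hp.pos hab]
  refine Finset.sum_congr rfl fun y _ => ?_
  rw [← Nat.cast_pow, AddChar.zmodChar_apply']

theorem norm_gaussSeven_of_eq_sum {p l : ℕ} {ζ : ℂ} (hζ : ‖ζ‖ = 1)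
    (h : gaussSeven ζ (p ^ (l + 1)) = ∑ y ∈ Finset.range (p ^ l), ζ ^ ((p * y) ^ 7)) :
    ‖gaussSeven ζ (p ^ (l + 1))‖ ≤ p ^ l := by
  rw [h]
  simpa [hζ] using norm_sum_le (Finset.range (p ^ l)) fun y => ζ ^ ((p * y) ^ 7)

theorem gaussSeven_of_eq_sum {p l : ℕ} {ζ : ℂ} (hζ : ζ ^ p ^ (l + 7) = 1)
    (h : gaussSeven ζ (p ^ (l + 7)) = ∑ y ∈ Finset.range (p ^ (l + 6)), ζ ^ ((p * y) ^ 7)) :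
    gaussSeven ζ (p ^ (l + 7)) = p ^ 6 * gaussSeven (ζ ^ p ^ 7) (p ^ l) := by
  have hper : ∀ x, (ζ ^ p ^ 7) ^ ((p ^ l + x) ^ 7) = (ζ ^ p ^ 7) ^ (x ^ 7) := by
    refine fun x => pow_pow_eq_of_modEq (q := p ^ l) ?_ (by simp [Nat.ModEq, Nat.pow_mod])
    rw [← pow_mul, ← pow_add, add_comm, hζ]
  have := sum_range_mul_of_periodic (F := fun x => (ζ ^ p ^ 7) ^ (x ^ 7)) hper (p ^ 6)
  rw [h, gaussSeven, add_comm l 6, pow_add]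
  simp only [mul_pow, pow_mul ζ]
  exact_mod_cast this
theorem card_filter_pow_seven_le {K : Type*} [Field K] [Fintype K] [DecidableEq K] (a : K) :
    (Finset.univ.filter fun x : K => x ^ 7 = a).card ≤ 7 := by
  refine le_trans ?_ (Polynomial.card_nthRoots 7 a)
  refine le_trans (Finset.card_le_card fun x hx => ?_) (Multiset.toFinset_card_le _)
  rw [Multiset.mem_toFinset, Polynomial.mem_nthRoots (by norm_num)]
  exact (Finset.mem_filter.1 hx).2

theorem gaussSeven_prime_pow_eq {p l : ℕ} (hp : p.Prime) (hp7 : p ≠ 7) {ζ : ℂ}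
    (hζ : IsPrimitiveRoot ζ (p ^ (l + 2))) :
    gaussSeven ζ (p ^ (l + 2)) = ∑ y ∈ Finset.range (p ^ (l + 1)), ζ ^ ((p * y) ^ 7) := by
  have h0 : (p : ZMod (p ^ (l + 2))) ^ (l + 2) = 0 := by
    rw [← Nat.cast_pow, ZMod.natCast_self]
  refine gaussSeven_prime_pow_eq_sum (N := p ^ (l + 1)) (c := 7 * p ^ (l + 1)) hp hζ ?_ ?_
  · intro x z
    push_cast
    linear_combination (21 * x ^ 5 * p ^ l * z ^ 2 + 35 * x ^ 4 * p ^ (2 * l + 1) * z ^ 3 +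
      35 * x ^ 3 * p ^ (3 * l + 2) * z ^ 4 + 21 * x ^ 2 * p ^ (4 * l + 3) * z ^ 5 +
      7 * x * p ^ (5 * l + 4) * z ^ 6 + p ^ (6 * l + 5) * z ^ 7) * h0
  · intro x
    rw [pow_succ p (l + 1), mul_comm 7, mul_assoc,
      Nat.mul_dvd_mul_iff_left (pow_pos hp.pos _), hp.dvd_mul,
      (Nat.prime_dvd_prime_iff_eq hp (by norm_num : Nat.Prime 7)), or_iff_right hp7]
    exact ⟨hp.dvd_of_dvd_pow, fun h => dvd_pow h (by norm_num)⟩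

theorem gaussSeven_seven_pow_eq {l : ℕ} {ζ : ℂ} (hζ : IsPrimitiveRoot ζ (7 ^ (l + 3))) :
    gaussSeven ζ (7 ^ (l + 3)) = ∑ y ∈ Finset.range (7 ^ (l + 2)), ζ ^ ((7 * y) ^ 7) := by
  have h0 : (7 : ZMod (7 ^ (l + 3))) ^ (l + 3) = 0 := by
    have := ZMod.natCast_self (7 ^ (l + 3))
    exact_mod_cast this
  refine gaussSeven_prime_pow_eq_sum (N := 7 ^ (l + 1)) (c := 7 ^ (l + 2)) (by norm_num) hζ ?_ ?_
  · intro x z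
    push_cast
    linear_combination (3 * x ^ 5 * 7 ^ l * z ^ 2 + 5 * x ^ 4 * 7 ^ (2 * l + 1) * z ^ 3 +
      5 * x ^ 3 * 7 ^ (3 * l + 2) * z ^ 4 + 3 * x ^ 2 * 7 ^ (4 * l + 3) * z ^ 5 +
      x * 7 ^ (5 * l + 4) * z ^ 6 + 7 ^ (6 * l + 4) * z ^ 7) * h0
  · intro x
    have hp : Nat.Prime 7 := by norm_num
    rw [pow_succ 7 (l + 2), Nat.mul_dvd_mul_iff_left (pow_pos hp.pos _)]
    exact ⟨hp.dvd_of_dvd_pow, fun h => dvd_pow h (by norm_num)⟩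

theorem sum_normSq_sum_mul_pow_seven {p : ℕ} [Fact p.Prime] {ψ : AddChar (ZMod p) ℂ}
    (hψ : ψ.IsPrimitive) : ∑ a, ‖∑ x, ψ (a * x ^ 7)‖ ^ 2 ≤ 7 * (p : ℝ) ^ 2 := by
  have h1 : ((∑ a, ‖∑ x, ψ (a * x ^ 7)‖ ^ 2 : ℝ) : ℂ) =
      ∑ y : ZMod p, ∑ x : ZMod p, (if x ^ 7 - y ^ 7 = 0 then (p : ℂ) else 0) := by
    have h2 : ∀ a, ((‖∑ x, ψ (a * x ^ 7)‖ ^ 2 : ℝ) : ℂ) =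
        ∑ y : ZMod p, ∑ x : ZMod p, ψ (a * (x ^ 7 - y ^ 7)) := by
      intro a
      rw [Complex.ofReal_pow, ← Complex.conj_mul', map_sum, Finset.sum_mul_sum]
      refine Finset.sum_congr rfl fun y _ => Finset.sum_congr rfl fun x _ => ?_
      rw [← AddChar.map_neg_eq_conj, ← AddChar.map_add_eq_mul]
      ring_nf
    rw [Complex.ofReal_sum, Finset.sum_congr rfl fun a _ => h2 a, Finset.sum_comm]
    refine Finset.sum_congr rfl fun y _ => ?_
    rw [Finset.sum_comm]
    refine Finset.sum_congr rfl fun x _ => ?_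
    rw [AddChar.sum_mulShift _ hψ, ZMod.card]
    split_ifs <;> simp
  have h3 : ∀ y : ZMod p, (∑ x : ZMod p, if x ^ 7 - y ^ 7 = 0 then (p : ℝ) else 0) ≤ 7 * p := by
    intro y
    rw [← Finset.sum_filter, Finset.sum_const, nsmul_eq_mul]
    simp only [sub_eq_zero]
    gcongr
    exact_mod_cast card_filter_pow_seven_le (y ^ 7)
  have h4 : ∑ a, ‖∑ x, ψ (a * x ^ 7)‖ ^ 2 =
      ∑ y : ZMod p, ∑ x : ZMod p, (if x ^ 7 - y ^ 7 = 0 then (p : ℝ) else 0) := by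
    apply Complex.ofReal_injective
    rw [h1]
    simp only [Complex.ofReal_sum, apply_ite Complex.ofReal, Complex.ofReal_natCast,
      Complex.ofReal_zero]
  rw [h4]
  refine (Finset.sum_le_sum fun y _ => h3 y).trans_eq ?_
  simp only [Finset.sum_const, Finset.card_univ, ZMod.card, nsmul_eq_mul]
  ring

theorem norm_sq_gaussSeven_prime_mul_le {p : ℕ} (hp : p.Prime) {ζ : ℂ} (hζ : IsPrimitiveRoot ζ p) :
    ‖gaussSeven ζ p‖ ^ 2 * (p - 1) ≤ 49 * (p : ℝ) ^ 2 := by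
  have := Fact.mk hp
  rw [gaussSeven_eq_sum_zmodChar hζ.pow_eq_one]
  have hψ := AddChar.zmodChar_primitive_of_primitive_root _ hζ
  set ψ := AddChar.zmodChar p hζ.pow_eq_one
  let F : ZMod p → ℝ := fun a => ‖∑ x, ψ (a * x ^ 7)‖ ^ 2
  have hF : ∀ z : ZMod p, z ≠ 0 → F (z ^ 7) = ‖∑ x, ψ (x ^ 7)‖ ^ 2 := by
    intro z hz
    have : ∑ x, ψ (z ^ 7 * x ^ 7) = ∑ x, ψ (x ^ 7) :=
      Fintype.sum_equiv (Equiv.mulLeft₀ z hz) _ _ fun x => by simp [mul_pow]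
    simp only [F, this]
  have hcard : ((Finset.univ.filter fun z : ZMod p => z ≠ 0).card : ℝ) = p - 1 := by
    rw [Finset.filter_ne', Finset.card_erase_of_mem (Finset.mem_univ _), Finset.card_univ,
      ZMod.card, Nat.cast_pred hp.pos]
  have h1 : ‖∑ x, ψ (x ^ 7)‖ ^ 2 * (p - 1) = ∑ z : ZMod p with z ≠ 0, F (z ^ 7) := by
    rw [Finset.sum_congr rfl fun z hz => hF z (Finset.mem_filter.1 hz).2, Finset.sum_const,
      nsmul_eq_mul, hcard, mul_comm]
  have h2 : ∑ z : ZMod p with z ≠ 0, F (z ^ 7) ≤ ∑ z, F (z ^ 7) :=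
    Finset.sum_le_sum_of_subset_of_nonneg (Finset.filter_subset _ _) fun _ _ _ => by positivity
  have h3 : ∑ z, F (z ^ 7) ≤ 7 * ∑ a, F a := by
    rw [← Finset.sum_fiberwise Finset.univ (fun z : ZMod p => z ^ 7), Finset.mul_sum]
    refine Finset.sum_le_sum fun a _ => ?_
    rw [Finset.sum_congr rfl fun z hz => by rw [(Finset.mem_filter.1 hz).2], Finset.sum_const,
      nsmul_eq_mul]
    gcongr
    exact_mod_cast card_filter_pow_seven_le a
  have h4 := sum_normSq_sum_mul_pow_seven hψ
  rw [h1]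
  linarith

/-- The factor at the prime `p` in the bound for complete sums of seventh powers. -/
def gaussConst (p : ℕ) : ℕ := if p = 7 then 49 else if p < 240 then p else 1

theorem one_le_gaussConst {p : ℕ} (hp : 0 < p) : 1 ≤ gaussConst p := by
  unfold gaussConst
  split_ifs <;> omega

theorem norm_gaussSeven_prime_le {p : ℕ} (hp : p.Prime) {ζ : ℂ} (hζ : IsPrimitiveRoot ζ p) :
    ‖gaussSeven ζ p‖ ^ 7 ≤ gaussConst p * (p : ℝ) ^ 6 := by
  have htriv : ‖gaussSeven ζ p‖ ^ 7 ≤ (p : ℝ) ^ 7 := by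
    gcongr
    exact norm_gaussSeven_le (hζ.norm'_eq_one hp.ne_zero) p
  unfold gaussConst
  split_ifs with h7 h240
  · subst h7
    refine htriv.trans ?_
    norm_num
  · rw [← pow_succ']
    exact htriv
  · have hpr : (240 : ℝ) ≤ p := by exact_mod_cast not_lt.1 h240
    have h1 : 0 < (p : ℝ) - 1 := by linarith
    have h2 := norm_sq_gaussSeven_prime_mul_le hp hζ
    have h3 : (7 : ℝ) ^ 14 * (p : ℝ) ^ 2 ≤ (p - 1) ^ 7 := by
      have h5 : (239 : ℝ) ^ 5 ≤ (p - 1) ^ 5 := by gcongr; linarith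
      have h6 : (p : ℝ) ≤ 240 / 239 * (p - 1) := by linarith
      calc (7 : ℝ) ^ 14 * (p : ℝ) ^ 2 ≤ 7 ^ 14 * (240 / 239 * ((p : ℝ) - 1)) ^ 2 := by gcongr
        _ = (7 ^ 14 * (240 / 239) ^ 2) * ((p : ℝ) - 1) ^ 2 := by ring
        _ ≤ (239 ^ 5) * ((p : ℝ) - 1) ^ 2 := by gcongr; norm_num
        _ ≤ ((p : ℝ) - 1) ^ 5 * ((p : ℝ) - 1) ^ 2 := by gcongr
        _ = _ := by ring
    refine le_of_pow_le_pow_left₀ two_ne_zero (by positivity) ?_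
    refine le_of_mul_le_mul_right ?_ (pow_pos h1 7)
    calc (‖gaussSeven ζ p‖ ^ 7) ^ 2 * (p - 1 : ℝ) ^ 7 = (‖gaussSeven ζ p‖ ^ 2 * (p - 1)) ^ 7 := by
          ring
      _ ≤ (49 * (p : ℝ) ^ 2) ^ 7 := by gcongr
      _ = (p : ℝ) ^ 12 * (7 ^ 14 * (p : ℝ) ^ 2) := by ring
      _ ≤ (p : ℝ) ^ 12 * (p - 1) ^ 7 := by gcongr
      _ = _ := by push_cast; ring

theorem norm_gaussSeven_prime_pow_le {p : ℕ} (hp : p.Prime) (l : ℕ) {ζ : ℂ}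
    (hζ : IsPrimitiveRoot ζ (p ^ l)) :
    ‖gaussSeven ζ (p ^ l)‖ ^ 7 ≤ gaussConst p * ((p : ℝ) ^ l) ^ 6 := by
  have hc : (1 : ℝ) ≤ gaussConst p := by exact_mod_cast one_le_gaussConst hp.pos
  have hp1 : (1 : ℝ) ≤ p := by exact_mod_cast hp.one_le
  induction l using Nat.strong_induction_on generalizing ζ with
  | _ l ih =>
    have hn1 : ‖ζ‖ = 1 := hζ.norm'_eq_one (pow_pos hp.pos l).ne'
    have hred : ∀ j, l = j + 1 →
        gaussSeven ζ (p ^ (j + 1)) = ∑ y ∈ Finset.range (p ^ j), ζ ^ ((p * y) ^ 7) →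
        ‖gaussSeven ζ (p ^ l)‖ ^ 7 ≤ gaussConst p * ((p : ℝ) ^ l) ^ 6 := by
      rintro j rfl hj
      by_cases hj6 : j ≤ 6
      · have h1 := norm_gaussSeven_of_eq_sum hn1 hj
        calc ‖gaussSeven ζ (p ^ (j + 1))‖ ^ 7 ≤ ((p : ℝ) ^ j) ^ 7 := by gcongr
          _ = (p : ℝ) ^ (j * 7) := by rw [pow_mul]
          _ ≤ (p : ℝ) ^ ((j + 1) * 6) := pow_le_pow_right₀ hp1 (by omega)
          _ = ((p : ℝ) ^ (j + 1)) ^ 6 := by rw [pow_mul]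
          _ ≤ _ := le_mul_of_one_le_left (by positivity) hc
      · obtain ⟨i, rfl⟩ : ∃ i, j = i + 6 := ⟨j - 6, by omega⟩
        rw [gaussSeven_of_eq_sum hζ.pow_eq_one hj, norm_mul, mul_pow]
        have h1 := ih i (by omega) (hζ.pow (pow_pos hp.pos _) (by rw [← pow_add, add_comm 7 i]))
        calc ‖((p : ℂ) ^ 6)‖ ^ 7 * ‖gaussSeven (ζ ^ p ^ 7) (p ^ i)‖ ^ 7
            ≤ ((p : ℝ) ^ 6) ^ 7 * (gaussConst p * ((p : ℝ) ^ i) ^ 6) := by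
              gcongr
              simp
          _ = _ := by ring
    rcases Nat.lt_or_ge l 2 with hl | hl
    · interval_cases l
      · simpa [gaussSeven] using hc
      · simpa using norm_gaussSeven_prime_le hp (by simpa using hζ)
    · obtain ⟨i, rfl⟩ : ∃ i, l = i + 2 := ⟨l - 2, by omega⟩
      by_cases h7 : p = 7
      · subst h7
        rcases Nat.eq_zero_or_pos i with rfl | hi
        · have h1 := norm_gaussSeven_le hn1 (7 ^ (0 + 2))
          calc ‖gaussSeven ζ (7 ^ (0 + 2))‖ ^ 7 ≤ ((7 ^ (0 + 2) : ℕ) : ℝ) ^ 7 := by gcongr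
            _ ≤ _ := by norm_num [gaussConst]
        · obtain ⟨k, rfl⟩ : ∃ k, i = k + 1 := ⟨i - 1, by omega⟩
          exact hred (k + 2) rfl (gaussSeven_seven_pow_eq hζ)
      · exact hred (i + 1) rfl (gaussSeven_prime_pow_eq hp h7 hζ)

theorem norm_gaussSeven_le_prod {q : ℕ} (hq : 0 < q) {ζ : ℂ} (hζ : IsPrimitiveRoot ζ q) :
    ‖gaussSeven ζ q‖ ^ 7 ≤ (∏ p ∈ q.primeFactors, (gaussConst p : ℝ)) * (q : ℝ) ^ 6 := by
  induction q using Nat.recOnPosPrimePosCoprime generalizing ζ with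
  | prime_pow p l hp hl =>
    rw [Nat.primeFactors_prime_pow hl.ne' hp, Finset.prod_singleton, Nat.cast_pow]
    exact norm_gaussSeven_prime_pow_le hp l hζ
  | zero => exact absurd hq (lt_irrefl 0)
  | one => simp [gaussSeven]
  | coprime a b ha hb hab iha ihb =>
    have ha0 : 0 < a := by omega
    have hb0 : 0 < b := by omega
    rw [gaussSeven_mul ha0 hb0 hab hζ.pow_eq_one, hab.primeFactors_mul,
      Finset.prod_union hab.disjoint_primeFactors, norm_mul, mul_pow]
    have h1 : IsPrimitiveRoot (ζ ^ b ^ 7) a := by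
      have := (hζ.pow hq (mul_comm a b)).pow_of_coprime (b ^ 6) (hab.symm.pow_left 6)
      rwa [← pow_mul, ← pow_succ'] at this
    have h2 : IsPrimitiveRoot (ζ ^ a ^ 7) b := by
      have := (hζ.pow hq rfl).pow_of_coprime (a ^ 6) (hab.pow_left 6)
      rwa [← pow_mul, ← pow_succ'] at this
    refine (mul_le_mul (iha ha0 h1) (ihb hb0 h2) (by positivity) (by positivity)).trans_eq ?_
    push_cast
    ring

theorem prod_gaussConst_le (s : Finset ℕ) (hs : ∀ p ∈ s, p.Prime) :
    ∏ p ∈ s, gaussConst p ≤ 4 ^ 239 * 7 := by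
  have h1 : ∏ p ∈ s, gaussConst p ≤ ∏ p ∈ s.filter (· ≤ 239), gaussConst p := by
    rw [Finset.prod_filter]
    refine Finset.prod_le_prod' fun p _ => ?_
    split_ifs with h
    · exact le_rfl
    · rw [gaussConst, if_neg (by omega), if_neg (by omega)]
  have h2 : ∏ p ∈ s.filter (· ≤ 239), gaussConst p ≤
      ∏ p ∈ (Finset.range 240).filter Nat.Prime, gaussConst p := by
    refine Finset.prod_le_prod_of_subset_of_one_le' (fun p hp => ?_) fun p hp _ =>
      one_le_gaussConst (Finset.mem_filter.1 hp).2.pos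
    rw [Finset.mem_filter] at hp
    exact Finset.mem_filter.2 ⟨Finset.mem_range.2 (by omega), hs p hp.1⟩
  have h3 : ∏ p ∈ (Finset.range 240).filter Nat.Prime, gaussConst p ≤
      ∏ p ∈ (Finset.range 240).filter Nat.Prime, p * (if p = 7 then 7 else 1) := by
    refine Finset.prod_le_prod' fun p hp => ?_
    have := Finset.mem_range.1 (Finset.mem_filter.1 hp).1
    unfold gaussConst
    split_ifs with h <;> simp [h]
  have h4 : ∀ s : Finset ℕ, ∏ p ∈ s, (if p = 7 then 7 else 1) ≤ 7 := fun s => by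
    rw [Finset.prod_ite_eq']
    split_ifs <;> norm_num
  rw [Finset.prod_mul_distrib] at h3
  exact h1.trans (h2.trans (h3.trans (Nat.mul_le_mul (primorial_le_four_pow 239) (h4 _))))

theorem norm_gaussSeven_pow_seven_le {q : ℕ} (hq : 0 < q) {ζ : ℂ} (hζ : IsPrimitiveRoot ζ q) :
    ‖gaussSeven ζ q‖ ^ 7 ≤ 2 ^ 481 * (q : ℝ) ^ 6 := by
  refine (norm_gaussSeven_le_prod hq hζ).trans ?_
  have h1 : (∏ p ∈ q.primeFactors, (gaussConst p : ℝ)) ≤ 4 ^ 239 * 7 := by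
    exact_mod_cast prod_gaussConst_le q.primeFactors fun p hp => Nat.prime_of_mem_primeFactors hp
  have h2 : (4 : ℝ) ^ 239 * 7 ≤ 2 ^ (2 * 239 + 3) := by
    rw [pow_add, pow_mul]
    norm_num
  gcongr
  exact h1.trans h2

/-- The additive character `x ↦ exp (2 π i x)` of the reals. -/
noncomputable def unitExp (x : ℝ) : ℂ := Complex.exp (Complex.I * ((2 * Real.pi * x : ℝ) : ℂ))

theorem unitExp_zero : unitExp 0 = 1 := by simp [unitExp]

theorem unitExp_add (x y : ℝ) : unitExp (x + y) = unitExp x * unitExp y := by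
  rw [unitExp, unitExp, unitExp, ← Complex.exp_add]
  push_cast
  ring_nf

theorem unitExp_neg (x : ℝ) : unitExp (-x) = (starRingEnd ℂ) (unitExp x) := by
  rw [unitExp, unitExp, ← Complex.exp_conj, map_mul, Complex.conj_I, Complex.conj_ofReal]
  push_cast
  ring_nf

theorem norm_unitExp (x : ℝ) : ‖unitExp x‖ = 1 := by
  rw [unitExp, mul_comm, Complex.norm_exp_ofReal_mul_I]

theorem unitExp_intCast (n : ℤ) : unitExp n = 1 := by
  rw [unitExp, Complex.exp_eq_one_iff]
  exact ⟨n, by push_cast; ring⟩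

theorem unitExp_add_intCast (x : ℝ) (n : ℤ) : unitExp (x + n) = unitExp x := by
  rw [unitExp_add, unitExp_intCast, mul_one]

theorem unitExp_nat_mul (n : ℕ) (x : ℝ) : unitExp (n * x) = unitExp x ^ n := by
  rw [unitExp, unitExp, ← Complex.exp_nat_mul]
  push_cast
  ring_nf

theorem unitExp_sum {ι : Type*} (s : Finset ι) (f : ι → ℝ) :
    unitExp (∑ i ∈ s, f i) = ∏ i ∈ s, unitExp (f i) := by
  classical
  induction s using Finset.induction_on with
  | empty => simp [unitExp_zero]
  | insert i s hi ih => rw [Finset.sum_insert hi, Finset.prod_insert hi, unitExp_add, ih]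

theorem norm_sum_unitExp_le {ι : Type*} (s : Finset ι) (f : ι → ℝ) :
    ‖∑ i ∈ s, unitExp (f i)‖ ≤ s.card := by
  simpa [norm_unitExp] using norm_sum_le s fun i => unitExp (f i)

theorem norm_unitExp_sub_one_le (x : ℝ) : ‖unitExp x - 1‖ ≤ 2 * Real.pi * |x| := by
  have := Real.norm_exp_I_mul_ofReal_sub_one_le (x := 2 * Real.pi * x)
  rwa [Real.norm_eq_abs, abs_mul, abs_of_pos Real.two_pi_pos] at this

theorem norm_unitExp_sub_le (x y : ℝ) : ‖unitExp x - unitExp y‖ ≤ 2 * Real.pi * |x - y| := by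
  have h : unitExp x - unitExp y = unitExp y * (unitExp (x - y) - 1) := by
    rw [mul_sub, ← unitExp_add, mul_one, add_sub_cancel]
  rw [h, norm_mul, norm_unitExp, one_mul]
  exact norm_unitExp_sub_one_le _

theorem norm_unitExp_sub_one_sub_le (x : ℝ) :
    ‖unitExp x - 1 - Complex.I * ((2 * Real.pi * x : ℝ) : ℂ)‖ ≤ 2 * (2 * Real.pi * x) ^ 2 := by
  have hn : ‖Complex.I * ((2 * Real.pi * x : ℝ) : ℂ)‖ = |2 * Real.pi * x| := by
    rw [norm_mul, Complex.norm_I, one_mul, Complex.norm_real, Real.norm_eq_abs]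
  rcases le_total |2 * Real.pi * x| 1 with h | h
  · have := Complex.norm_exp_sub_one_sub_id_le (hn.trans_le h)
    rw [hn, sq_abs] at this
    exact this.trans (by nlinarith [sq_nonneg (2 * Real.pi * x)])
  · have h1 := norm_unitExp_sub_one_le x
    rw [← abs_of_pos Real.two_pi_pos, ← abs_mul] at h1
    have h2 := norm_sub_le (unitExp x - 1) (Complex.I * ((2 * Real.pi * x : ℝ) : ℂ))
    rw [hn] at h2
    rw [← sq_abs]
    nlinarith

/-- Partial summation: a telescoping sum with decreasing weights. -/
theorem norm_sum_antitone_mul_sub_le {E : ℕ → ℂ} (hE : ∀ y, ‖E y‖ ≤ 1) {w : ℕ → ℝ}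
    (hw : Antitone w) (hw0 : ∀ y, 0 ≤ w y) (n : ℕ) :
    ‖∑ y ∈ Finset.range n, (w y : ℂ) * (E (y + 1) - E y)‖ ≤ 2 * w 0 := by
  have hwE : ∀ {c : ℝ}, 0 ≤ c → ∀ y, ‖(c : ℂ) * E y‖ ≤ c := fun {c} hc y => by
    rw [norm_mul, Complex.norm_real, Real.norm_of_nonneg hc]
    exact mul_le_of_le_one_right hc (hE y)
  have key : ‖∑ y ∈ Finset.range n, (w y : ℂ) * (E (y + 1) - E y) - w n * E n‖ ≤
      2 * w 0 - w n := by
    induction n with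
    | zero =>
      rw [Finset.sum_range_zero, zero_sub, norm_neg]
      linarith [hwE (hw0 0) 0]
    | succ n ih =>
      have h1 := hwE (sub_nonneg.2 (hw (Nat.le_add_right n 1))) (n + 1)
      rw [Complex.ofReal_sub] at h1
      have h2 := (norm_add_le _ _).trans (add_le_add ih h1)
      rw [Finset.sum_range_succ]
      refine le_of_eq_of_le (congrArg _ ?_) (h2.trans_eq ?_) <;> ring
  have h1 := norm_le_norm_sub_add (∑ y ∈ Finset.range n, (w y : ℂ) * (E (y + 1) - E y)) (w n * E n)
  linarith [hwE (hw0 n) n]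

theorem norm_sum_unitExp_le_of_monotone {φ : ℕ → ℝ} (hmono : Monotone fun y => φ (y + 1) - φ y)
    (hpos : 0 < φ 1 - φ 0) (n : ℕ) :
    ‖∑ y ∈ Finset.range n, unitExp (φ y)‖ ≤
      1 / (Real.pi * (φ 1 - φ 0)) + 4 * Real.pi * (φ n - φ 0) := by
  have hπ := Real.pi_pos
  set D : ℕ → ℝ := fun y => φ (y + 1) - φ y with hD
  have hDpos : ∀ y, 0 < D y := fun y => lt_of_lt_of_le hpos (hmono (Nat.zero_le y))
  let w : ℕ → ℝ := fun y => 1 / (2 * Real.pi * D y)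
  have hstep : ∀ y, ‖unitExp (φ y) - -Complex.I * ((w y : ℂ) * (unitExp (φ (y + 1)) - unitExp (φ y)))‖
      ≤ 4 * Real.pi * D y := by
    intro y
    have h1 : unitExp (φ (y + 1)) = unitExp (φ y) * unitExp (D y) := by
      rw [← unitExp_add, hD]
      simp
    have h2 : (2 * Real.pi * D y) ≠ 0 := (mul_pos Real.two_pi_pos (hDpos y)).ne'
    have h3 : unitExp (φ y) - -Complex.I * ((w y : ℂ) * (unitExp (φ (y + 1)) - unitExp (φ y))) =
        unitExp (φ y) * (Complex.I * w y) *
          (unitExp (D y) - 1 - Complex.I * ((2 * Real.pi * D y : ℝ) : ℂ)) := by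
      have h4 : (w y : ℂ) * ((2 * Real.pi * D y : ℝ) : ℂ) = 1 := by
        rw [← Complex.ofReal_mul]
        simp only [w, one_div_mul_cancel h2, Complex.ofReal_one]
      rw [h1]
      linear_combination (-unitExp (φ y)) * h4 + unitExp (φ y) * (w y : ℂ) * ((2 * Real.pi * D y : ℝ) : ℂ) * Complex.I_sq
    have hwy : 0 < w y := one_div_pos.2 (mul_pos Real.two_pi_pos (hDpos y))
    rw [h3, norm_mul, norm_mul, norm_unitExp, norm_mul, Complex.norm_I, one_mul, one_mul,
      Complex.norm_real, Real.norm_of_nonneg hwy.le]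
    refine (mul_le_mul_of_nonneg_left (norm_unitExp_sub_one_sub_le (D y)) hwy.le).trans_eq ?_
    simp only [w]
    have := (hDpos y).ne'
    field_simp
    ring
  have hw : Antitone w := fun x y hxy =>
    one_div_le_one_div_of_le (mul_pos Real.two_pi_pos (hDpos x))
      (mul_le_mul_of_nonneg_left (hmono hxy) Real.two_pi_pos.le)
  have h1 := norm_sum_antitone_mul_sub_le (E := fun y => unitExp (φ y))
    (fun y => (norm_unitExp _).le) hw
    (fun y => (one_div_pos.2 (mul_pos Real.two_pi_pos (hDpos y))).le) n
  have h2 : ‖∑ y ∈ Finset.range n, (unitExp (φ y) -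
      -Complex.I * ((w y : ℂ) * (unitExp (φ (y + 1)) - unitExp (φ y))))‖ ≤
      4 * Real.pi * (φ n - φ 0) := by
    refine (norm_sum_le_of_le _ fun y _ => hstep y).trans_eq ?_
    rw [← Finset.mul_sum, Finset.sum_range_sub]
  rw [Finset.sum_sub_distrib, ← Finset.mul_sum] at h2
  have h3 := norm_le_norm_sub_add (∑ y ∈ Finset.range n, unitExp (φ y))
    (-Complex.I * ∑ y ∈ Finset.range n, (w y : ℂ) * (unitExp (φ (y + 1)) - unitExp (φ y)))
  rw [norm_mul, norm_neg, Complex.norm_I, one_mul] at h3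
  have h4 : 2 * w 0 = 1 / (Real.pi * (φ 1 - φ 0)) := by
    simp only [w, hD]
    have := hpos.ne'
    field_simp
  rw [← h4]
  linarith

theorem sum_range_pow_add_pow_seven {ζ : ℂ} {b : ℕ} (hb : 0 < b) (hζ : ζ ^ b = 1) (P : ℕ) :
    ∑ c ∈ Finset.range b, ζ ^ ((P + c) ^ 7) = gaussSeven ζ b := by
  have : NeZero b := ⟨hb.ne'⟩
  rw [gaussSeven_eq_sum_zmodChar hζ,
    ← Fintype.sum_equiv (Equiv.addLeft (P : ZMod b)) (fun x => AddChar.zmodChar b hζ ((P + x) ^ 7)) _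
      fun x => rfl, ← sum_range_natCast_zmod]
  refine Finset.sum_congr rfl fun c _ => ?_
  rw [← AddChar.zmodChar_apply' hζ]
  push_cast
  rfl

theorem sum_range_mul_eq (F : ℕ → ℂ) (b n : ℕ) :
    ∑ x ∈ Finset.range (b * n), F x =
      ∑ y ∈ Finset.range n, ∑ c ∈ Finset.range b, F (b * y + c) := by
  induction n with
  | zero => simp
  | succ n ih => rw [mul_add, mul_one, Finset.sum_range_add, ih, Finset.sum_range_succ]

theorem norm_sum_range_sub_sum_blocks_le {F : ℕ → ℂ} (hF : ∀ x, ‖F x‖ ≤ 1) {b : ℕ} (hb : 0 < b)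
    (P : ℕ) :
    ‖∑ x ∈ Finset.range P, F x -
      ∑ y ∈ Finset.range (P / b), ∑ c ∈ Finset.range b, F (b * y + c)‖ ≤ b := by
  rw [← sum_range_mul_eq]
  nth_rw 1 [← Nat.div_add_mod P b]
  rw [Finset.sum_range_add, add_sub_cancel_left]
  refine (norm_sum_le_of_le _ fun x _ => hF _).trans ?_
  simpa using (Nat.mod_lt P hb).le

theorem add_pow_seven_sub_le {u c A : ℝ} (hu : 0 ≤ u) (hc : 0 ≤ c) (h : u + c ≤ A) :
    (u + c) ^ 7 - u ^ 7 ≤ 7 * A ^ 6 * c := by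
  have h1 : (u + c) ^ 7 - u ^ 7 ≤ 7 * (u + c) ^ 6 * c := by
    have : 7 * (u + c) ^ 6 * c - ((u + c) ^ 7 - u ^ 7) = c ^ 2 * (21 * u ^ 5 + 70 * u ^ 4 * c +
      105 * u ^ 3 * c ^ 2 + 84 * u ^ 2 * c ^ 3 + 35 * u * c ^ 4 + 6 * c ^ 5) := by ring
    have : 0 ≤ c ^ 2 * (21 * u ^ 5 + 70 * u ^ 4 * c +
      105 * u ^ 3 * c ^ 2 + 84 * u ^ 2 * c ^ 3 + 35 * u * c ^ 4 + 6 * c ^ 5) := by positivity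
    linarith
  refine h1.trans ?_
  gcongr

theorem norm_sum_unitExp_pow_seven_le {P b : ℕ} (hP : 0 < P) (hb : 0 < b) {β : ℝ} (hβ : β ≠ 0) :
    ‖∑ y ∈ Finset.range (P / b), unitExp (β * ((P + b * y : ℕ) : ℝ) ^ 7)‖ ≤
      P / b * (1 / (|β| * P ^ 7)) + 1609 * (|β| * P ^ 7) := by
  wlog hpos : 0 < β generalizing β with H
  · have h1 := H (neg_ne_zero.2 hβ) (neg_pos.2 (lt_of_le_of_ne (not_lt.1 hpos) hβ))
    rw [abs_neg] at h1
    refine le_of_eq_of_le ?_ h1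
    rw [← Complex.norm_conj, map_sum]
    simp only [neg_mul, unitExp_neg]
  rw [abs_of_pos hpos]
  have hPr : (0 : ℝ) < P := Nat.cast_pos.2 hP
  have hbr : (0 : ℝ) < b := Nat.cast_pos.2 hb
  let φ : ℕ → ℝ := fun y => β * ((P + b * y : ℕ) : ℝ) ^ 7
  have hD : ∀ y, φ (y + 1) - φ y = β * (7 * ((P : ℝ) + b * y) ^ 6 * b +
      21 * ((P : ℝ) + b * y) ^ 5 * b ^ 2 + 35 * ((P : ℝ) + b * y) ^ 4 * b ^ 3 +
      35 * ((P : ℝ) + b * y) ^ 3 * b ^ 4 + 21 * ((P : ℝ) + b * y) ^ 2 * b ^ 5 +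
      7 * ((P : ℝ) + b * y) * b ^ 6 + b ^ 7) := by
    intro y
    simp only [φ]
    push_cast
    ring
  have hmono : Monotone fun y => φ (y + 1) - φ y := by
    intro y z hyz
    have : (y : ℝ) ≤ z := Nat.cast_le.2 hyz
    simp only [hD]
    gcongr
  have h0 : β * (7 * (P : ℝ) ^ 6 * b) ≤ φ 1 - φ 0 := by
    have := hD 0
    rw [zero_add] at this
    rw [this, Nat.cast_zero, mul_zero, add_zero]
    refine mul_le_mul_of_nonneg_left ?_ hpos.le
    have : 0 ≤ 21 * (P : ℝ) ^ 5 * b ^ 2 + 35 * (P : ℝ) ^ 4 * b ^ 3 + 35 * (P : ℝ) ^ 3 * b ^ 4 +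
      21 * (P : ℝ) ^ 2 * b ^ 5 + 7 * (P : ℝ) * b ^ 6 + b ^ 7 := by positivity
    linarith
  have h0pos : 0 < β * (7 * (P : ℝ) ^ 6 * b) := by positivity
  have hend : φ (P / b) - φ 0 ≤ 128 * (β * P ^ 7) := by
    have h1 : ((P + b * (P / b) : ℕ) : ℝ) ≤ 2 * P := by
      exact_mod_cast (by have := Nat.mul_div_le P b; omega : P + b * (P / b) ≤ 2 * P)
    have h2 : φ (P / b) ≤ β * (2 * P) ^ 7 := by
      simp only [φ]
      gcongr
    have h3 : 0 ≤ φ 0 := by positivity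
    linarith
  refine (norm_sum_unitExp_le_of_monotone hmono (h0pos.trans_le h0) (P / b)).trans ?_
  have hπ := Real.pi_gt_three
  have hπ' := Real.pi_lt_d4
  gcongr ?_ + ?_
  · calc 1 / (Real.pi * (φ 1 - φ 0)) ≤ 1 / (1 * (β * (7 * (P : ℝ) ^ 6 * b))) := by
          gcongr
          linarith
      _ = 1 / 7 * (P / b * (1 / (β * P ^ 7))) := by
          field_simp
      _ ≤ 1 * (P / b * (1 / (β * P ^ 7))) := by
          gcongr
          norm_num
      _ = _ := one_mul _
  · calc 4 * Real.pi * (φ (P / b) - φ 0) ≤ 4 * Real.pi * (128 * (β * P ^ 7)) := by gcongr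
      _ = (512 * Real.pi) * (β * P ^ 7) := by ring
      _ ≤ 1609 * (β * P ^ 7) := by
          gcongr
          linarith

theorem norm_sum_unitExp_rat_add_le {P b : ℕ} (hP : 0 < P) (hb : 0 < b) (a : ℤ) {β : ℝ}
    (hβ : β ≠ 0) :
    ‖∑ x ∈ Finset.range P, unitExp ((a / b + β) * ((P + x : ℕ) : ℝ) ^ 7)‖ ≤
      ‖gaussSeven (unitExp (a / b)) b‖ * (P / b * min 1 (1 / (|β| * P ^ 7))) + b +
        4424 * (b * (|β| * P ^ 7)) := by
  have hPr : (0 : ℝ) < P := Nat.cast_pos.2 hP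
  have hbr : (0 : ℝ) < b := Nat.cast_pos.2 hb
  set ζ := unitExp (a / b) with hζ
  set t := |β| * (P : ℝ) ^ 7 with ht
  have ht0 : 0 ≤ t := by positivity
  have hζb : ζ ^ b = 1 := by
    rw [hζ, ← unitExp_nat_mul, mul_div_cancel₀ _ hbr.ne', unitExp_intCast]
  set F : ℕ → ℂ := fun x => unitExp ((a / b + β) * ((P + x : ℕ) : ℝ) ^ 7) with hF
  set T := ∑ y ∈ Finset.range (P / b), unitExp (β * ((P + b * y : ℕ) : ℝ) ^ 7) with hT
  have hπ' := Real.pi_lt_d4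
  have hY : ((P / b : ℕ) : ℝ) ≤ P / b := Nat.cast_div_le
  have h1 : ‖∑ x ∈ Finset.range P, F x -
      ∑ y ∈ Finset.range (P / b), ∑ c ∈ Finset.range b, F (b * y + c)‖ ≤ b :=
    norm_sum_range_sub_sum_blocks_le (fun x => (norm_unitExp _).le) hb P
  have h2 : ‖∑ y ∈ Finset.range (P / b), ∑ c ∈ Finset.range b, F (b * y + c) -
      gaussSeven ζ b * T‖ ≤ 2815 * (b * t) := by
    rw [← sum_range_pow_add_pow_seven hb hζb P, mul_comm, hT, Finset.sum_mul_sum,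
      ← Finset.sum_sub_distrib]
    simp only [← Finset.sum_sub_distrib]
    have hterm : ∀ y ∈ Finset.range (P / b), ∀ c ∈ Finset.range b,
        ‖F (b * y + c) - unitExp (β * ((P + b * y : ℕ) : ℝ) ^ 7) * ζ ^ ((P + c) ^ 7)‖ ≤
          2 * Real.pi * (|β| * (7 * (2 * P) ^ 6 * b)) := by
      intro y hy c hc
      rw [Finset.mem_range] at hy hc
      have h3 : F (b * y + c) =
          unitExp (β * ((P + (b * y + c) : ℕ) : ℝ) ^ 7) * ζ ^ ((P + c) ^ 7) := by
        have h4 : ζ ^ ((P + c) ^ 7) = ζ ^ ((P + (b * y + c)) ^ 7) := by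
          refine pow_pow_eq_of_modEq hζb (Nat.ModEq.pow 7 ?_)
          rw [show P + (b * y + c) = P + c + b * y by ring]
          simp [Nat.ModEq]
        rw [h4, hζ, ← unitExp_nat_mul, ← unitExp_add]
        simp only [hF]
        push_cast
        ring_nf
      rw [h3, ← sub_mul, norm_mul, norm_pow, hζ, norm_unitExp, one_pow, mul_one]
      refine (norm_unitExp_sub_le _ _).trans ?_
      rw [← mul_sub, abs_mul]
      have h5 : P + b * y + c ≤ 2 * P := by
        have h6 : b * (y + 1) ≤ P := (Nat.mul_le_mul_left b hy).trans (Nat.mul_div_le P b)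
        rw [mul_add, mul_one] at h6
        omega
      have h7 := add_pow_seven_sub_le (u := ((P + b * y : ℕ) : ℝ)) (c := (c : ℝ))
        (A := 2 * P) (by positivity) (by positivity) (by exact_mod_cast h5)
      have h8 : (((P + (b * y + c) : ℕ) : ℝ)) = ((P + b * y : ℕ) : ℝ) + c := by
        push_cast
        ring
      have h9 : (0 : ℝ) ≤ (((P + b * y : ℕ) : ℝ) + c) ^ 7 - ((P + b * y : ℕ) : ℝ) ^ 7 :=
        sub_nonneg.2 (pow_le_pow_left₀ (by positivity) (le_add_of_nonneg_right (by positivity)) 7)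
      have h10 : (c : ℝ) ≤ b := by exact_mod_cast hc.le
      rw [h8, abs_of_nonneg h9]
      gcongr
      exact h7.trans (by gcongr)
    refine (norm_sum_le_of_le _ fun y hy => norm_sum_le_of_le _ (hterm y hy)).trans ?_
    simp only [Finset.sum_const, Finset.card_range, nsmul_eq_mul]
    have hYb : ((P / b : ℕ) : ℝ) * b ≤ P := by
      exact_mod_cast Nat.div_mul_le_self P b
    calc ((P / b : ℕ) : ℝ) * (b * (2 * Real.pi * (|β| * (7 * (2 * P) ^ 6 * b))))
        = (((P / b : ℕ) : ℝ) * b) * (2 * Real.pi * (|β| * (7 * (2 * P) ^ 6 * b))) := by ring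
      _ ≤ P * (2 * Real.pi * (|β| * (7 * (2 * P) ^ 6 * b))) := by gcongr
      _ = (896 * Real.pi) * (b * t) := by rw [ht]; ring
      _ ≤ 2815 * (b * t) := by
          gcongr
          linarith
  have h3 : ‖T‖ ≤ P / b * min 1 (1 / t) + 1609 * t := by
    rcases min_choice 1 (1 / t) with h | h
    · rw [h, mul_one]
      have := (norm_sum_unitExp_le (Finset.range (P / b))
        fun y => β * ((P + b * y : ℕ) : ℝ) ^ 7).trans_eq (by rw [Finset.card_range])
      exact (this.trans hY).trans (le_add_of_nonneg_right (by positivity))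
    · rw [h]
      exact norm_sum_unitExp_pow_seven_le hP hb hβ
  have h4 := norm_gaussSeven_le (norm_unitExp (a / b)) b
  have h5 : ‖gaussSeven ζ b * T‖ ≤
      ‖gaussSeven ζ b‖ * (P / b * min 1 (1 / t)) + b * (1609 * t) := by
    rw [norm_mul]
    calc ‖gaussSeven ζ b‖ * ‖T‖ ≤ ‖gaussSeven ζ b‖ * (P / b * min 1 (1 / t) + 1609 * t) := by gcongr
      _ = ‖gaussSeven ζ b‖ * (P / b * min 1 (1 / t)) + ‖gaussSeven ζ b‖ * (1609 * t) := by ring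
      _ ≤ _ := by gcongr
  have h6 := norm_le_norm_sub_add (∑ x ∈ Finset.range P, F x)
    (∑ y ∈ Finset.range (P / b), ∑ c ∈ Finset.range b, F (b * y + c))
  have h7 := norm_le_norm_sub_add
    (∑ y ∈ Finset.range (P / b), ∑ c ∈ Finset.range b, F (b * y + c)) (gaussSeven ζ b * T)
  linarith

theorem isPrimitiveRoot_unitExp (r : ℚ) : IsPrimitiveRoot (unitExp (r.num / r.den)) r.den := by
  convert Complex.isPrimitiveRoot_exp_rat r using 1
  rw [unitExp]
  congr 1
  nth_rw 3 [← Rat.num_div_den r]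
  push_cast
  ring

theorem norm_sum_unitExp_rat_add_pow_le {P : ℕ} (hP : 0 < P) (r : ℚ) {β δ : ℝ} (hβ : β ≠ 0)
    (hδ : r.den + 4424 * (r.den * (|β| * P ^ 7)) ≤ δ * P) :
    ‖∑ x ∈ Finset.range P, unitExp ((r + β) * ((P + x : ℕ) : ℝ) ^ 7)‖ ^ 28 ≤
      2 ^ 27 * (P : ℝ) ^ 28 *
        ((2 ^ 481) ^ 4 / (r.den ^ 2 * (r.den * (|β| * P ^ 7)) ^ 2) + δ ^ 28) := by
  have hb := r.den_pos
  have hPr : (0 : ℝ) < P := Nat.cast_pos.2 hP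
  have h1 := norm_sum_unitExp_rat_add_le hP hb r.num hβ
  have h2 := norm_gaussSeven_pow_seven_le hb (isPrimitiveRoot_unitExp r)
  rw [show (r : ℝ) = r.num / r.den from Rat.cast_def r]
  have hbr : (0 : ℝ) < r.den := Nat.cast_pos.2 hb
  set g := ‖gaussSeven (unitExp (r.num / r.den)) r.den‖ with hg
  set t := |β| * (P : ℝ) ^ 7 with ht
  have ht0 : 0 < t := by positivity
  generalize (r.den : ℝ) = b at *
  have hδ0 : 0 ≤ δ := by
    have : 0 ≤ δ * P := le_trans (by positivity) hδ
    exact nonneg_of_mul_nonneg_left this hPr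
  have hmin : (min 1 (1 / t)) ^ 28 ≤ 1 / t ^ 2 := by
    have h3 : 0 ≤ min 1 (1 / t) := le_min zero_le_one (by positivity)
    calc (min 1 (1 / t)) ^ 28 ≤ (min 1 (1 / t)) ^ 2 :=
          pow_le_pow_of_le_one h3 (min_le_left _ _) (by norm_num)
      _ ≤ (1 / t) ^ 2 := by gcongr; exact min_le_right _ _
      _ = _ := by rw [div_pow, one_pow]
  have h4 : (g * (P / b * min 1 (1 / t))) ^ 28 ≤
      (P : ℝ) ^ 28 * ((2 ^ 481) ^ 4 / (b ^ 2 * (b * t) ^ 2)) := by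
    calc (g * (P / b * min 1 (1 / t))) ^ 28
        = (g ^ 7) ^ 4 * ((P / b) ^ 28 * (min 1 (1 / t)) ^ 28) := by ring
      _ ≤ (2 ^ 481 * b ^ 6) ^ 4 * ((P / b) ^ 28 * (1 / t ^ 2)) := by gcongr
      _ = _ := by
        generalize (2 : ℝ) ^ 481 = A
        field_simp
  calc _ ≤ (g * (P / b * min 1 (1 / t)) + δ * P) ^ 28 := by
        gcongr
        linarith
    _ ≤ 2 ^ (28 - 1) * ((g * (P / b * min 1 (1 / t))) ^ 28 + (δ * P) ^ 28) :=
        add_pow_le (mul_nonneg (norm_nonneg _) (mul_nonneg (by positivity)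
          (le_min zero_le_one (by positivity)))) (by positivity) 28
    _ ≤ 2 ^ (28 - 1) * ((P : ℝ) ^ 28 * ((2 ^ 481) ^ 4 / (b ^ 2 * (b * t) ^ 2)) + (δ * P) ^ 28) := by
        gcongr
    _ = _ := by
        generalize (2 : ℝ) ^ 481 = A
        rw [mul_pow]
        ring

theorem unitExp_eq_one_iff {x : ℝ} : unitExp x = 1 ↔ ∃ n : ℤ, x = n := by
  rw [unitExp, Complex.exp_eq_one_iff]
  refine exists_congr fun n => ?_
  have h : (n : ℂ) * (2 * Real.pi * Complex.I) = Complex.I * ((2 * Real.pi * n : ℝ) : ℂ) := by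
    push_cast
    ring
  rw [h, mul_right_inj' Complex.I_ne_zero, Complex.ofReal_inj, mul_right_inj' Real.two_pi_pos.ne']

theorem sum_unitExp_mul_div {M : ℕ} (hM : 0 < M) (k : ℤ) :
    ∑ h ∈ Finset.range M, unitExp (h / M * k) = if (M : ℤ) ∣ k then (M : ℂ) else 0 := by
  have hM0 : (M : ℝ) ≠ 0 := (Nat.cast_pos.2 hM).ne'
  have h1 : ∀ h : ℕ, unitExp (h / M * k) = unitExp (k / M) ^ h := fun h => by
    rw [← unitExp_nat_mul]
    ring_nf
  have h2 : unitExp (k / M) = 1 ↔ (M : ℤ) ∣ k := by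
    rw [unitExp_eq_one_iff, dvd_def]
    refine exists_congr fun n => ?_
    rw [div_eq_iff hM0, mul_comm (M : ℤ)]
    exact_mod_cast Iff.rfl
  simp only [h1]
  split_ifs with h
  · simp [h2.2 h]
  · rw [geom_sum_eq (mt h2.1 h), ← unitExp_nat_mul, mul_div_cancel₀ _ hM0, unitExp_intCast,
      sub_self, zero_div]

theorem sum_unitExp_mul_eq_zero {ι : Type*} {T : Finset ι} {F : ι → ℕ} {M n : ℕ} (hM : 0 < M)
    (hT : ∀ t ∈ T, ¬ F t ≡ n [MOD M]) :
    ∑ h ∈ Finset.range M, (∑ t ∈ T, unitExp (h / M * F t)) * unitExp (-(h / M * n)) = 0 := by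
  simp only [Finset.sum_mul, ← unitExp_add]
  rw [Finset.sum_comm]
  refine Finset.sum_eq_zero fun t ht => ?_
  have h1 := sum_unitExp_mul_div hM ((F t : ℤ) - n)
  rw [if_neg fun h => hT t ht (Nat.modEq_iff_dvd.2 ((dvd_sub_comm).1 h))] at h1
  rw [← h1]
  refine Finset.sum_congr rfl fun h _ => congrArg _ ?_
  push_cast
  ring

theorem normSq_sum_unitExp {ι : Type*} (s : Finset ι) (f : ι → ℝ) :
    ((‖∑ i ∈ s, unitExp (f i)‖ ^ 2 : ℝ) : ℂ) = ∑ i ∈ s, ∑ j ∈ s, unitExp (f i - f j) := by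
  rw [Complex.ofReal_pow, ← Complex.mul_conj', map_sum, Finset.sum_mul_sum]
  simp only [← unitExp_neg, ← unitExp_add, sub_eq_add_neg]

theorem sum_normSq_sum_unitExp {M : ℕ} {V : Finset ℕ} (hV : ∀ v ∈ V, v < M) :
    ∑ h ∈ Finset.range M, ‖∑ v ∈ V, unitExp (h / M * v)‖ ^ 2 = M * V.card := by
  rcases Nat.eq_zero_or_pos M with rfl | hM
  · simp
  apply Complex.ofReal_injective
  rw [Complex.ofReal_sum]
  simp only [normSq_sum_unitExp]
  rw [Finset.sum_comm]
  have key : ∀ v ∈ V, ∑ h ∈ Finset.range M, ∑ w ∈ V, unitExp (h / M * v - h / M * w) = M := by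
    intro v hv
    rw [Finset.sum_comm, Finset.sum_eq_single_of_mem v hv]
    · simp [unitExp_zero]
    · intro w hw hwv
      have h1 := sum_unitExp_mul_div hM ((v : ℤ) - w)
      rw [if_neg fun h => hwv ((Nat.modEq_iff_dvd.2 h).eq_of_lt_of_lt (hV w hw) (hV v hv))] at h1
      rw [← h1]
      refine Finset.sum_congr rfl fun h _ => congrArg _ ?_
      push_cast
      ring
  rw [Finset.sum_congr rfl key]
  simp [mul_comm]

theorem four_mul_abs_sub_round_le (y : ℝ) : 4 * |y - round y| ≤ ‖unitExp y - 1‖ := by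
  have h1 : unitExp y = unitExp (y - round y) := by
    rw [← unitExp_add_intCast (y - round y) (round y), sub_add_cancel]
  rw [h1]
  set z := y - round y with hz
  have hz2 : |z| ≤ 1 / 2 := abs_sub_round y
  have h2 : ‖unitExp z - 1‖ = 2 * |Real.sin (Real.pi * z)| := by
    rw [unitExp, Complex.norm_exp_I_mul_ofReal_sub_one, norm_mul, Real.norm_eq_abs,
      Real.norm_eq_abs, abs_two]
    ring_nf
  have h3 := Real.mul_abs_le_abs_sin (x := Real.pi * z) (by
    rw [abs_mul, abs_of_pos Real.pi_pos]; nlinarith [Real.pi_pos])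
  rw [abs_mul, abs_of_pos Real.pi_pos, ← mul_assoc, div_mul_cancel₀ _ Real.pi_pos.ne'] at h3
  linarith

theorem norm_sum_range_unitExp_le {y c : ℝ} (hc : 0 < c) (hy : ∀ m : ℤ, 1 / (2 * c) ≤ |y - m|)
    (N : ℕ) : ‖∑ u ∈ Finset.range N, unitExp (y * u)‖ ≤ c := by
  have h1 := (mul_le_mul_of_nonneg_left (hy (round y)) zero_le_four).trans
    (four_mul_abs_sub_round_le y)
  have h2 : (∑ u ∈ Finset.range N, unitExp (y * u)) * (unitExp y - 1) = unitExp (y * N) - 1 := by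
    rw [mul_comm y N, unitExp_nat_mul, ← geom_sum_mul]
    simp only [← unitExp_nat_mul, mul_comm]
  have h3 : ‖∑ u ∈ Finset.range N, unitExp (y * u)‖ * ‖unitExp y - 1‖ ≤ 2 := by
    rw [← norm_mul, h2]
    refine (norm_sub_le _ _).trans ?_
    rw [norm_unitExp, norm_one]
    norm_num
  have h4 := (mul_le_mul_of_nonneg_left h1 (norm_nonneg _)).trans h3
  have h5 : 4 * (1 / (2 * c)) = 2 / c := by field_simp; norm_num
  rwa [h5, mul_div_assoc', div_le_iff₀ hc, mul_comm (2 : ℝ), mul_le_mul_iff_left₀ zero_lt_two] at h4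

theorem le_abs_mul_sub_intCast {θ : ℝ} {r : ℚ} {Q d : ℤ} (hQ : 0 < Q)
    (hr : |θ - r| ≤ 1 / (Q * r.den)) (hd0 : d ≠ 0) (hd : |d| < r.den) (hdQ : 2 * |d| ≤ Q) (m : ℤ) :
    1 / (2 * (r.den : ℝ)) ≤ |θ * d - m| := by
  have hb : (0 : ℝ) < r.den := Nat.cast_pos.2 r.den_pos
  have h1 : r.num * d - m * r.den ≠ 0 := by
    intro h
    have h2 : (r.den : ℤ) ∣ r.num * d := ⟨m, by linarith⟩
    have h3 : (r.den : ℤ) ∣ d := by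
      refine Int.dvd_of_dvd_mul_right_of_gcd_one h2 ?_
      rw [Int.gcd_comm]
      simpa [Int.gcd] using r.reduced
    exact absurd (Int.le_of_dvd (abs_pos.2 hd0) ((dvd_abs _ _).2 h3)) (not_le.2 hd)
  have h2 : (1 : ℝ) ≤ |r.num * d - m * r.den| := by exact_mod_cast Int.one_le_abs h1
  have h3 : (r : ℝ) * d - m = (r.num * d - m * r.den) / r.den := by
    nth_rw 1 [Rat.cast_def r]
    field_simp
  have h4 : 1 / (r.den : ℝ) ≤ |(r : ℝ) * d - m| := by
    rw [h3, abs_div, abs_of_pos hb]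
    gcongr
    exact_mod_cast h2
  have hQ' : (0 : ℝ) < Q := Int.cast_pos.2 hQ
  have hdQ' : 2 * |(d : ℝ)| ≤ Q := by exact_mod_cast hdQ
  have h5 : |(θ - r) * d| ≤ 1 / (2 * (r.den : ℝ)) := by
    rw [abs_mul]
    calc |θ - r| * |(d : ℝ)| ≤ 1 / (Q * r.den) * (Q / 2) := by gcongr; linarith
      _ = _ := by field_simp
  have h6 := abs_sub_abs_le_abs_sub ((r : ℝ) * d - m) (-((θ - r) * d))
  rw [abs_neg] at h6
  have h7 : (r : ℝ) * d - m - -((θ - r) * d) = θ * d - m := by ring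
  have h8 : 1 / (r.den : ℝ) = 2 * (1 / (2 * (r.den : ℝ))) := by field_simp
  rw [h7] at h6
  linarith

theorem normSq_sum_sum_unitExp_le {X N : ℕ} {U : Finset ℕ} (hU : U ⊆ Finset.range N) {g : ℕ → ℤ}
    {θ c : ℝ} (hc : 0 < c)
    (hg : ∀ x ∈ Finset.range X, ∀ y ∈ Finset.range X, x ≠ y → ∀ m : ℤ,
      1 / (2 * c) ≤ |θ * ((g x - g y : ℤ) : ℝ) - m|) :
    ‖∑ x ∈ Finset.range X, ∑ u ∈ U, unitExp (θ * (g x * u))‖ ^ 2 ≤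
      U.card * (X * N + X ^ 2 * c) := by
  rw [Finset.sum_comm]
  set H : ℕ → ℂ := fun u => ∑ x ∈ Finset.range X, unitExp (θ * (g x * u)) with hH
  have h1 : ‖∑ u ∈ U, H u‖ ^ 2 ≤ U.card * ∑ u ∈ Finset.range N, ‖H u‖ ^ 2 := by
    calc ‖∑ u ∈ U, H u‖ ^ 2 ≤ (∑ u ∈ U, ‖H u‖) ^ 2 := by gcongr; exact norm_sum_le _ _
      _ ≤ U.card * ∑ u ∈ U, ‖H u‖ ^ 2 := sq_sum_le_card_mul_sum_sq
      _ ≤ _ := by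
        gcongr
  refine h1.trans (mul_le_mul_of_nonneg_left ?_ (Nat.cast_nonneg _))
  have h2 : ∑ u ∈ Finset.range N, ‖H u‖ ^ 2 ≤ ∑ x ∈ Finset.range X, ∑ y ∈ Finset.range X,
      ‖∑ u ∈ Finset.range N, unitExp (θ * ((g x - g y : ℤ) : ℝ) * u)‖ := by
    have h3 : ((∑ u ∈ Finset.range N, ‖H u‖ ^ 2 : ℝ) : ℂ) = ∑ x ∈ Finset.range X,
        ∑ y ∈ Finset.range X, ∑ u ∈ Finset.range N, unitExp (θ * ((g x - g y : ℤ) : ℝ) * u) := by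
      rw [Complex.ofReal_sum]
      simp only [hH, normSq_sum_unitExp]
      rw [Finset.sum_comm]
      refine Finset.sum_congr rfl fun x _ => ?_
      rw [Finset.sum_comm]
      refine Finset.sum_congr rfl fun y _ => Finset.sum_congr rfl fun u _ => congrArg _ ?_
      push_cast
      ring
    have h4 : (0 : ℝ) ≤ ∑ u ∈ Finset.range N, ‖H u‖ ^ 2 := by positivity
    rw [← Real.norm_of_nonneg h4, ← Complex.norm_real, h3]
    exact (norm_sum_le _ _).trans (Finset.sum_le_sum fun x _ => norm_sum_le _ _)
  refine h2.trans ?_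
  have h5 : ∀ x ∈ Finset.range X, ∀ y ∈ Finset.range X,
      ‖∑ u ∈ Finset.range N, unitExp (θ * ((g x - g y : ℤ) : ℝ) * u)‖ ≤
        (if x = y then (N : ℝ) else 0) + c := by
    intro x hx y hy
    split_ifs with h
    · refine (norm_sum_unitExp_le _ _).trans ?_
      rw [Finset.card_range]
      linarith
    · rw [zero_add]
      exact norm_sum_range_unitExp_le hc (hg x hx y hy h) N
  refine (Finset.sum_le_sum fun x hx => Finset.sum_le_sum (h5 x hx)).trans_eq ?_
  simp only [Finset.sum_add_distrib, Finset.sum_ite_eq, Finset.sum_const, Finset.card_range,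
    nsmul_eq_mul]
  rw [Finset.sum_congr rfl fun x hx => if_pos hx]
  simp only [Finset.sum_const, Finset.card_range, nsmul_eq_mul]
  ring

theorem normSq_sum_pow_seven_mul_le {X N Q : ℕ} {U : Finset ℕ} (hU : U ⊆ Finset.range N) {θ : ℝ}
    {r : ℚ} (hr : |θ - r| ≤ 1 / ((Q + 1) * r.den)) (hX : X ^ 7 < r.den) (hQ : 2 * X ^ 7 ≤ Q) :
    ‖∑ x ∈ Finset.range X, ∑ u ∈ U, unitExp (θ * (((x + 1) ^ 7 * u : ℕ) : ℝ))‖ ^ 2 ≤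
      U.card * (X * N + X ^ 2 * r.den) := by
  have hc : (0 : ℝ) < r.den := Nat.cast_pos.2 r.den_pos
  have key := normSq_sum_sum_unitExp_le (X := X) hU (g := fun x => ((x + 1) ^ 7 : ℕ)) (θ := θ) hc ?_
  · simpa using key
  intro x hx y hy hxy m
  have hp : ∀ z ∈ Finset.range X, (((z + 1) ^ 7 : ℕ) : ℤ) ≤ X ^ 7 ∧ 0 < (((z + 1) ^ 7 : ℕ) : ℤ) := by
    intro z hz
    refine ⟨?_, by positivity⟩
    exact_mod_cast Nat.pow_le_pow_left (Finset.mem_range.1 hz) 7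
  have h1 : |(((x + 1) ^ 7 : ℕ) : ℤ) - ((y + 1) ^ 7 : ℕ)| ≤ X ^ 7 := by
    rw [abs_le]
    constructor <;> linarith [hp x hx, hp y hy]
  refine le_abs_mul_sub_intCast (Q := Q + 1) (by positivity) (by push_cast; exact hr) ?_
    (h1.trans_lt (by exact_mod_cast hX)) ?_ m
  · rw [sub_ne_zero]
    intro h
    have h2 := Nat.pow_left_injective (n := 7) (by norm_num) (Int.ofNat_inj.1 h)
    omega
  · have : (2 * X ^ 7 : ℤ) ≤ Q := by exact_mod_cast hQ
    linarith

theorem add_pow_seven_injective_of_gap {z x x' v v' : ℕ} (hx : 2 ^ z < x) (hx' : 2 ^ z < x')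
    (hv : v ≤ 2 ^ (6 * z)) (hv' : v' ≤ 2 ^ (6 * z)) (h : x ^ 7 + v = x' ^ 7 + v') :
    x = x' ∧ v = v' := by
  have key : ∀ {a b c : ℕ}, 2 ^ z < a → a < b → c ≤ 2 ^ (6 * z) → a ^ 7 + c < b ^ 7 := by
    intro a b c ha hab hc
    have h1 : (2 ^ z) ^ 6 < a ^ 6 := Nat.pow_lt_pow_left ha (by norm_num)
    have h2 : (a + 1) ^ 7 ≤ b ^ 7 := Nat.pow_le_pow_left hab 7
    have h3 : a ^ 7 + a ^ 6 ≤ (a + 1) ^ 7 := by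
      rw [show (a + 1) ^ 7 = a ^ 7 + a ^ 6 + (6 * a ^ 6 + 21 * a ^ 5 + 35 * a ^ 4 + 35 * a ^ 3 +
        21 * a ^ 2 + 7 * a + 1) by ring]
      exact Nat.le_add_right _ _
    rw [← pow_mul, mul_comm] at h1
    omega
  rcases lt_trichotomy x x' with hlt | rfl | hlt
  · have := key hx hlt hv
    omega
  · exact ⟨rfl, by omega⟩
  · have := key hx' hlt hv'
    omega

/-- Large sets of sums of `t` positive seventh powers below a power of two, built by adding to a
seventh power near the upper end the elements of a set for a smaller bound. -/
theorem exists_finset_isRepr (t : ℕ) : ∀ e : ℕ, 84 * 7 ^ t ≤ 6 ^ t * (e + 84) →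
    ∃ (V : Finset ℕ) (s : ℕ), V.card = 2 ^ s ∧ (∀ v ∈ V, v ≤ 2 ^ e ∧ IsRepr v t 7) ∧
      7 ^ t * e ≤ 7 ^ t * s + 6 ^ t * e + 14 * t * 7 ^ t := by
  induction t with
  | zero => exact fun e _ => ⟨{0}, 0, by simp, by simp [isRepr_zero], by simp⟩
  | succ t ih =>
    intro e he
    have h67 : 6 ^ t ≤ 7 ^ t := Nat.pow_le_pow_left (by norm_num) t
    have h6 : 0 < 6 ^ t := by positivity
    have he14 : 14 ≤ e := by
      by_contra! h
      rw [pow_succ, pow_succ] at he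
      nlinarith
    obtain ⟨z, hz, hz'⟩ : ∃ z, 7 * z + 8 ≤ e ∧ e ≤ 7 * z + 14 := ⟨(e - 8) / 7, by omega, by omega⟩
    obtain ⟨V, s, hcard, hV, hs⟩ := ih (6 * z) (by
      rw [pow_succ, pow_succ] at he
      nlinarith)
    refine ⟨(Finset.Ioc (2 ^ z) (2 ^ (z + 1)) ×ˢ V).image fun y => y.1 ^ 7 + y.2, z + s, ?_, ?_, ?_⟩
    · rw [Finset.card_image_of_injOn, Finset.card_product, Nat.card_Ioc, hcard, pow_succ, pow_add]
      · congr 1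
        omega
      · rintro ⟨x, v⟩ hy ⟨x', v'⟩ hy' h
        simp only [Finset.coe_product, Set.mem_prod, Finset.mem_coe, Finset.mem_Ioc] at hy hy'
        obtain ⟨rfl, rfl⟩ := add_pow_seven_injective_of_gap hy.1.1 hy'.1.1 (hV _ hy.2).1
          (hV _ hy'.2).1 h
        rfl
    · intro w hw
      obtain ⟨⟨x, v⟩, hy, rfl⟩ := Finset.mem_image.1 hw
      simp only [Finset.mem_product, Finset.mem_Ioc] at hy
      refine ⟨?_, ?_⟩
      · have h1 : x ^ 7 ≤ 2 ^ (7 * z + 7) := by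
          rw [show 7 * z + 7 = (z + 1) * 7 by ring, pow_mul]
          exact Nat.pow_le_pow_left hy.1.2 7
        have h2 : v ≤ 2 ^ (7 * z + 7) := (hV v hy.2).1.trans (Nat.pow_le_pow_right two_pos (by omega))
        calc x ^ 7 + v ≤ 2 ^ (7 * z + 7 + 1) := by rw [pow_succ 2 (7 * z + 7)]; omega
          _ ≤ 2 ^ e := Nat.pow_le_pow_right two_pos hz
      · rw [add_comm (x ^ 7)]
        exact (hV v hy.2).2.add (isRepr_pow (pos_of_gt hy.1.1) 7)
    · rw [pow_succ, pow_succ]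
      obtain ⟨c, hc⟩ := Nat.exists_eq_add_of_le h67
      rw [hc] at hs ⊢
      nlinarith

theorem sum_Icc_one_div_sq_le (n : ℕ) : ∑ k ∈ Finset.Icc 1 n, 1 / (k : ℝ) ^ 2 ≤ 2 := by
  have h := sum_Ioo_inv_sq_le (α := ℝ) 0 (n + 1)
  rw [Nat.cast_zero, zero_add, div_one] at h
  have hI : Finset.Icc 1 n = Finset.Ioo 0 (n + 1) := by
    ext
    simp only [Finset.mem_Icc, Finset.mem_Ioo]
    omega
  simpa only [one_div, hI] using h

theorem sum_norm_pow_le_of_den_le {p C B K Q : ℕ} (hp : p.Prime) (hBp : B < p) (hC : 0 < C) {δ : ℝ}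
    (hδ : (B : ℝ) + 4424 * (K * C ^ 7) ≤ δ * (C * p : ℕ)) (hK : p ^ 7 ≤ K * (Q + 1)) (r : ℕ → ℚ)
    (hr : ∀ h : ℕ, |(h : ℝ) / (p ^ 7 : ℕ) - r h| ≤ 1 / ((Q + 1) * (r h).den)) :
    ∑ h ∈ (Finset.range (p ^ 7)).filter (fun h => h ≠ 0 ∧ (r h).den ≤ B),
      ‖∑ x ∈ Finset.range (C * p), unitExp ((h : ℝ) / (p ^ 7 : ℕ) * ((C * p + x : ℕ) : ℝ) ^ 7)‖ ^ 28 ≤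
      2 ^ 27 * ((C * p : ℕ) : ℝ) ^ 28 * (8 * ((2 ^ 481) ^ 4 / C ^ 14) + 2 * B * K * δ ^ 28) := by
  have hM : 0 < p ^ 7 := pow_pos hp.pos 7
  have hMr : (0 : ℝ) < (p ^ 7 : ℕ) := Nat.cast_pos.2 hM
  have hP : 0 < C * p := Nat.mul_pos hC hp.pos
  have hCr : (0 : ℝ) < C := Nat.cast_pos.2 hC
  set H := (Finset.range (p ^ 7)).filter (fun h => h ≠ 0 ∧ (r h).den ≤ B) with hH
  let k : ℕ → ℤ := fun h => h * (r h).den - (r h).num * (p ^ 7 : ℕ)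
  have hbr : ∀ h, (0 : ℝ) < (r h).den := fun h => Nat.cast_pos.2 (r h).den_pos
  have hβ : ∀ h : ℕ, (h : ℝ) / (p ^ 7 : ℕ) - r h = k h / ((r h).den * (p ^ 7 : ℕ)) := by
    intro h
    nth_rw 1 [Rat.cast_def (r h)]
    have := (hbr h).ne'
    simp only [k]
    push_cast
    have : (p : ℝ) ≠ 0 := Nat.cast_ne_zero.2 hp.ne_zero
    field_simp
  have hcop : ∀ h ∈ H, IsCoprime ((p ^ 7 : ℕ) : ℤ) ((r h).den : ℤ) := by
    intro h hh
    rw [Nat.isCoprime_iff_coprime]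
    exact Nat.Coprime.pow_left 7 (Nat.coprime_of_lt_prime (r h).den_ne_zero
      ((Finset.mem_filter.1 hh).2.2.trans_lt hBp) hp)
  have hk0 : ∀ h ∈ H, k h ≠ 0 := by
    intro h hh hk
    simp only [hH, Finset.mem_filter, Finset.mem_range] at hh
    have h1 : ((p ^ 7 : ℕ) : ℤ) ∣ h * (r h).den := ⟨(r h).num, by simp only [k] at hk; linarith⟩
    have h2 := Int.natCast_dvd_natCast.1
      ((hcop h (by simpa [hH] using hh)).dvd_of_dvd_mul_right h1)
    exact hh.2.1 (Nat.eq_zero_of_dvd_of_lt h2 hh.1)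
  have hkK : ∀ h, (k h).natAbs ≤ K := by
    intro h
    have h1 := hr h
    rw [hβ, abs_div, abs_of_pos (mul_pos (hbr h) hMr), div_le_div_iff₀ (mul_pos (hbr h) hMr)
      (by have := hbr h; positivity), one_mul, mul_comm ((r h).den : ℝ), ← mul_assoc] at h1
    have h2 := le_of_mul_le_mul_right h1 (hbr h)
    have h3 : ((p ^ 7 : ℕ) : ℝ) ≤ K * (Q + 1) := by exact_mod_cast hK
    have h4 := le_of_mul_le_mul_right (h2.trans h3) (by positivity)
    have h5 : (((k h).natAbs : ℤ) : ℝ) ≤ K := by rwa [Int.natCast_natAbs, Int.cast_abs]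
    exact_mod_cast h5
  have hterm : ∀ h ∈ H,
      ‖∑ x ∈ Finset.range (C * p), unitExp ((h : ℝ) / (p ^ 7 : ℕ) * ((C * p + x : ℕ) : ℝ) ^ 7)‖ ^ 28 ≤
      2 ^ 27 * ((C * p : ℕ) : ℝ) ^ 28 * ((2 ^ 481) ^ 4 / C ^ 14 *
        (1 / ((r h).den : ℝ) ^ 2 * (1 / ((k h).natAbs : ℝ) ^ 2)) + δ ^ 28) := by
    intro h hh
    have hkh := hk0 h hh
    have hb : (r h).den * (|(h : ℝ) / (p ^ 7 : ℕ) - r h| * ((C * p : ℕ) : ℝ) ^ 7) =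
        (k h).natAbs * (C : ℝ) ^ 7 := by
      rw [hβ, abs_div, abs_of_pos (mul_pos (hbr h) hMr), Nat.cast_natAbs]
      have := (hbr h).ne'
      have : (p : ℝ) ≠ 0 := Nat.cast_ne_zero.2 hp.ne_zero
      push_cast
      field_simp
    have hβ0 : (h : ℝ) / (p ^ 7 : ℕ) - r h ≠ 0 := by
      rw [hβ]
      exact div_ne_zero (Int.cast_ne_zero.2 hkh) (mul_pos (hbr h) hMr).ne'
    have key := norm_sum_unitExp_rat_add_pow_le hP (r h) (δ := δ) hβ0 (by
      rw [hb]
      refine le_trans ?_ hδ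
      have h1 : ((r h).den : ℝ) ≤ B := Nat.cast_le.2 (Finset.mem_filter.1 hh).2.2
      have h2 : ((k h).natAbs : ℝ) ≤ K := Nat.cast_le.2 (hkK h)
      gcongr)
    rw [hb, add_sub_cancel] at key
    refine key.trans_eq ?_
    congr 2
    have := (hbr h).ne'
    have : ((k h).natAbs : ℝ) ≠ 0 := by exact_mod_cast Int.natAbs_ne_zero.2 hkh
    generalize (2 : ℝ) ^ 481 = A
    field_simp
  refine (Finset.sum_le_sum hterm).trans ?_
  rw [← Finset.mul_sum]
  refine mul_le_mul_of_nonneg_left ?_ (by positivity)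
  let φ : ℕ → (ℕ × ℕ) × Bool := fun h => (((r h).den, (k h).natAbs), decide (0 < k h))
  set T : Finset ((ℕ × ℕ) × Bool) := (Finset.Icc 1 B ×ˢ Finset.Icc 1 K) ×ˢ Finset.univ with hT
  have hφT : ∀ h ∈ H, φ h ∈ T := by
    intro h hh
    simp only [hT, φ, Finset.mem_product, Finset.mem_Icc, Finset.mem_univ, and_true]
    exact ⟨⟨(r h).den_pos, (Finset.mem_filter.1 hh).2.2⟩,
      Nat.pos_of_ne_zero (Int.natAbs_ne_zero.2 (hk0 h hh)), hkK h⟩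
  have hinj : Set.InjOn φ H := by
    intro h hh h' hh' hφ
    simp only [φ, Prod.mk.injEq, decide_eq_decide] at hφ
    obtain ⟨⟨hb, hk⟩, hs⟩ := hφ
    have hk' : k h = k h' := by omega
    have h1 : ((p ^ 7 : ℕ) : ℤ) ∣ ((h' : ℤ) - h) * (r h).den := by
      refine ⟨(r h').num - (r h).num, ?_⟩
      simp only [k, ← hb] at hk'
      linear_combination -hk'
    have h2 := (hcop h hh).dvd_of_dvd_mul_right h1
    exact (Nat.modEq_iff_dvd.2 h2).eq_of_lt_of_lt (Finset.mem_range.1 (Finset.mem_filter.1 hh).1)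
      (Finset.mem_range.1 (Finset.mem_filter.1 hh').1)
  have hA0 : 0 ≤ (2 ^ 481 : ℝ) ^ 4 / C ^ 14 := by positivity
  generalize (2 ^ 481 : ℝ) ^ 4 / C ^ 14 = A at hA0 ⊢
  let F : (ℕ × ℕ) × Bool → ℝ := fun y =>
    A * (1 / (y.1.1 : ℝ) ^ 2 * (1 / (y.1.2 : ℝ) ^ 2)) + δ ^ 28
  have hF : ∀ y, 0 ≤ F y := fun y => by
    have : 0 ≤ δ ^ 28 := Even.pow_nonneg (by decide) δ
    positivity
  calc ∑ h ∈ H, (A * (1 / ((r h).den : ℝ) ^ 2 * (1 / ((k h).natAbs : ℝ) ^ 2)) + δ ^ 28)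
      = ∑ y ∈ H.image φ, F y := (Finset.sum_image (f := F) hinj).symm
    _ ≤ ∑ y ∈ T, F y := Finset.sum_le_sum_of_subset_of_nonneg
        (Finset.image_subset_iff.2 hφT) fun y _ _ => hF y
    _ = 2 * A * ((∑ b ∈ Finset.Icc 1 B, 1 / (b : ℝ) ^ 2) * ∑ k ∈ Finset.Icc 1 K, 1 / (k : ℝ) ^ 2) +
        2 * B * K * δ ^ 28 := by
      rw [hT, Finset.sum_product]
      simp only [F, Finset.sum_const, Finset.card_univ, Fintype.card_bool, ← Finset.smul_sum]
      rw [Finset.sum_add_distrib, ← Finset.mul_sum, Finset.sum_mul_sum, Finset.sum_product]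
      simp only [Finset.sum_const, Finset.card_product, Nat.card_Icc, nsmul_eq_mul]
      push_cast
      simp
      ring
    _ ≤ 2 * A * (2 * 2) + 2 * B * K * δ ^ 28 := by
      gcongr
      · exact sum_Icc_one_div_sq_le B
      · exact sum_Icc_one_div_sq_le K
    _ = _ := by ring

/-- The major and minor arcs together cannot cancel the main term. -/
theorem sum_range_ne_zero_of_arc_bounds {M : ℕ} (hM : 0 < M) {f G W e : ℕ → ℂ} {P A v : ℝ}
    (hP : 0 < P) (hA : 0 < A) (hv : 0 < v) (major : ℕ → Prop) [DecidablePred major]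
    (hf : ∀ h, ‖f h‖ ≤ P) (hG : ∀ h, ‖G h‖ ≤ A) (hW : ∀ h, ‖W h‖ ≤ v) (he : ∀ h, ‖e h‖ = 1)
    (hf0 : f 0 = P) (hG0 : G 0 = A) (hW0 : W 0 = v)
    (hminor : ∀ h, ¬ major h → 4 * (M * ‖G h‖) ≤ A * v)
    (hmajor : ∑ h ∈ (Finset.range M).filter (fun h => h ≠ 0 ∧ major h), ‖f h‖ ^ 28 ≤ P ^ 28 / 4)
    (hpars : ∑ h ∈ Finset.range M, ‖W h‖ ^ 2 = M * v) :
    ∑ h ∈ Finset.range M, f h ^ 28 * G h * W h ^ 2 * e h ≠ 0 := by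
  intro h0
  set t : ℕ → ℂ := fun h => f h ^ 28 * G h * W h ^ 2 * e h with ht
  have hnorm : ∀ h, ‖t h‖ = ‖f h‖ ^ 28 * ‖G h‖ * ‖W h‖ ^ 2 := fun h => by
    simp [ht, he]
  have hMr : (0 : ℝ) < M := Nat.cast_pos.2 hM
  rw [← Finset.add_sum_erase _ t (Finset.mem_range.2 hM)] at h0
  have ht0 : ‖t 0‖ = P ^ 28 * A * v ^ 2 := by
    rw [hnorm, hf0, hG0, hW0]
    simp [abs_of_pos hP, abs_of_pos hA]
  have h1 : ‖t 0‖ ≤ ∑ h ∈ (Finset.range M).erase 0, ‖t h‖ := by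
    rw [eq_neg_of_add_eq_zero_left h0, norm_neg]
    exact norm_sum_le _ _
  rw [← Finset.sum_filter_add_sum_filter_not _ major] at h1
  have h2 : ∑ h ∈ ((Finset.range M).erase 0).filter major, ‖t h‖ ≤ P ^ 28 / 4 * (A * v ^ 2) := by
    have hs : ((Finset.range M).erase 0).filter major =
        (Finset.range M).filter (fun h => h ≠ 0 ∧ major h) := by
      ext h
      simp only [Finset.mem_filter, Finset.mem_erase]
      tauto
    rw [hs]
    refine le_trans ?_ (mul_le_mul_of_nonneg_right hmajor (by positivity))
    rw [Finset.sum_mul]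
    refine Finset.sum_le_sum fun h _ => ?_
    rw [hnorm, mul_assoc]
    have := hG h
    have := hW h
    gcongr
  have h3 : ∑ h ∈ ((Finset.range M).erase 0).filter (fun h => ¬ major h), ‖t h‖ ≤
      P ^ 28 * (A * v / (4 * M)) * (M * v) := by
    rw [← hpars, Finset.mul_sum]
    refine le_trans (Finset.sum_le_sum (g := fun h => P ^ 28 * (A * v / (4 * M)) * ‖W h‖ ^ 2)
      fun h hh => ?_) (Finset.sum_le_sum_of_subset_of_nonneg
        ((Finset.filter_subset _ _).trans (Finset.erase_subset _ _)) fun h _ _ => by positivity)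
    have h4 := hminor h (Finset.mem_filter.1 hh).2
    have h5 : ‖G h‖ ≤ A * v / (4 * M) := by
      rw [le_div_iff₀ (by positivity)]
      linarith
    have := hf h
    rw [hnorm]
    gcongr
  have h4 : P ^ 28 * (A * v / (4 * M)) * (M * v) = P ^ 28 / 4 * (A * v ^ 2) := by field_simp
  have h5 : 0 < P ^ 28 * A * v ^ 2 := by positivity
  linarith

theorem circle_product_eq {θ : ℝ} {P X : ℕ} (U V : Finset ℕ) :
    (∑ x ∈ Finset.range P, unitExp (θ * ((P + x : ℕ) : ℝ) ^ 7)) ^ 28 *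
        (∑ x ∈ Finset.range X, ∑ u ∈ U, unitExp (θ * (((x + 1) ^ 7 * u : ℕ) : ℝ))) *
        (∑ v ∈ V, unitExp (θ * v)) ^ 2 =
      ∑ t ∈ (Fintype.piFinset fun _ : Fin 28 => Finset.range P) ×ˢ
          ((Finset.range X ×ˢ U) ×ˢ (V ×ˢ V)),
        unitExp (θ * ((∑ i, (P + t.1 i) ^ 7 +
          ((t.2.1.1 + 1) ^ 7 * t.2.1.2 + (t.2.2.1 + t.2.2.2)) : ℕ) : ℝ)) := by
  rw [Finset.sum_pow', ← Finset.sum_product', sq, mul_assoc]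
  simp only [Finset.sum_mul_sum, ← Finset.sum_product']
  refine Finset.sum_congr rfl fun t _ => ?_
  rw [← unitExp_sum, ← unitExp_add, ← unitExp_add, ← unitExp_add]
  refine congrArg _ ?_
  push_cast
  rw [← Finset.mul_sum]
  ring

theorem major_arc_numerics {k : ℕ} (hk : 6000 ≤ k) :
    (2 : ℝ) ^ 27 * (8 * ((2 ^ 481) ^ 4 / (2 ^ 141) ^ 14) +
      2 * 2 ^ (7 * k) * 2 ^ (8 * k + 7) * (2 ^ 867 / 2 ^ k) ^ 28) ≤ 1 / 4 := by
  have h1 : ((2 : ℝ) ^ 481) ^ 4 / (2 ^ 141) ^ 14 = 1 / 2 ^ 50 := by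
    rw [← pow_mul, ← pow_mul, show 141 * 14 = 481 * 4 + 50 by norm_num, pow_add]
    generalize h : (2 : ℝ) ^ (481 * 4) = A
    have : A ≠ 0 := by rw [← h]; positivity
    field_simp
  have h2 : (2 : ℝ) * 2 ^ (7 * k) * 2 ^ (8 * k + 7) * (2 ^ 867 / 2 ^ k) ^ 28 ≤ 1 / 2 ^ 30 := by
    rw [div_pow, mul_div_assoc', div_le_div_iff₀ (by positivity) (by positivity), one_mul,
      ← pow_mul, ← pow_mul, ← pow_succ', ← pow_add, ← pow_add, ← pow_add]
    exact pow_le_pow_right₀ one_le_two (by omega)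
  rw [h1]
  generalize (2 : ℝ) * 2 ^ (7 * k) * 2 ^ (8 * k + 7) * (2 ^ 867 / 2 ^ k) ^ 28 = y at h2 ⊢
  norm_num at h2 ⊢
  linarith

theorem major_arc_error_le {k p : ℕ} (hp : 2 ^ (9 * k) < p) :
    ((2 ^ (7 * k) : ℕ) : ℝ) + 4424 * ((2 ^ (8 * k + 7) : ℕ) * (2 ^ 141 : ℕ) ^ 7) ≤
      2 ^ 867 / 2 ^ k * ((2 ^ 141 * p : ℕ) : ℝ) := by
  have h1 : (2 : ℝ) ^ (9 * k) ≤ p := by exact_mod_cast hp.le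
  have h2 : (2 : ℝ) ^ (8 * k + 1008) ≤ 2 ^ 867 / 2 ^ k * (2 ^ 141 * p) := by
    rw [div_mul_eq_mul_div, le_div_iff₀ (by positivity), ← mul_assoc, ← pow_add, ← pow_add,
      show 8 * k + 1008 + k = 867 + 141 + 9 * k by ring, pow_add]
    gcongr
  have h3 : (2 : ℝ) ^ (7 * k) ≤ 2 ^ (8 * k + 1007) := pow_le_pow_right₀ one_le_two (by omega)
  have h4 : (4424 : ℝ) * (2 ^ (8 * k + 7) * (2 ^ 141) ^ 7) ≤ 2 ^ (8 * k + 1007) := by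
    calc (4424 : ℝ) * (2 ^ (8 * k + 7) * (2 ^ 141) ^ 7)
        ≤ 2 ^ 13 * (2 ^ (8 * k + 7) * (2 ^ 141) ^ 7) := by
          refine mul_le_mul_of_nonneg_right (by norm_num) (by positivity)
      _ = 2 ^ (8 * k + 1007) := by
          rw [← pow_mul, ← pow_add, ← pow_add]
          exact congrArg _ (by omega)
  have h5 : (2 : ℝ) ^ (8 * k + 1008) = 2 * 2 ^ (8 * k + 1007) := by
    rw [show 8 * k + 1008 = (8 * k + 1007) + 1 by ring, pow_succ, mul_comm]
  rw [h5] at h2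
  rw [Nat.cast_mul]
  simp only [Nat.cast_pow, Nat.cast_ofNat]
  exact (add_le_add h3 h4).trans ((two_mul _).symm.trans_le h2)

theorem four_mul_norm_le_of_minor {k M b s s' : ℕ} {U : Finset ℕ} {g : ℝ} (hg0 : 0 ≤ g)
    (hU : U.card = 2 ^ s) (hM : M ≤ 2 ^ (63 * k + 7)) (hb : b ≤ 2 ^ (55 * k))
    (hs : 182 * k + 20 ≤ k + s + 2 * s')
    (hg : g ^ 2 ≤ U.card * ((2 ^ k : ℕ) * (2 ^ (56 * k) + 1 : ℕ) + (2 ^ k : ℕ) ^ 2 * b)) :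
    4 * (M * g) ≤ 2 ^ k * 2 ^ s * 2 ^ s' := by
  have hM' : (M : ℝ) ≤ 2 ^ (63 * k + 7) := by exact_mod_cast hM
  have hb' : (b : ℝ) ≤ 2 ^ (55 * k) := by exact_mod_cast hb
  have h1 : g ^ 2 ≤ 2 ^ s * (2 ^ k * (4 * 2 ^ (56 * k))) := by
    refine hg.trans ?_
    rw [hU]
    push_cast
    refine mul_le_mul_of_nonneg_left ?_ (by positivity)
    rw [sq, mul_assoc, ← mul_add]
    refine mul_le_mul_of_nonneg_left ?_ (by positivity)
    have h2 : (2 : ℝ) ^ k * b ≤ 2 ^ (56 * k) := by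
      calc (2 : ℝ) ^ k * b ≤ 2 ^ k * 2 ^ (55 * k) := by gcongr
        _ = 2 ^ (56 * k) := by rw [← pow_add]; congr 1; omega
    have h3 : (1 : ℝ) ≤ 2 ^ (56 * k) := one_le_pow₀ one_le_two
    linarith
  refine (sq_le_sq₀ (by positivity) (by positivity)).1 ?_
  calc (4 * (M * g)) ^ 2 = 2 ^ 4 * (M ^ 2 * g ^ 2) := by ring
    _ ≤ 2 ^ 4 * ((2 ^ (63 * k + 7)) ^ 2 * (2 ^ s * (2 ^ k * (2 ^ 2 * 2 ^ (56 * k))))) := by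
      norm_num at h1 ⊢
      gcongr
    _ = 2 ^ (182 * k + 20 + k + s) := by
      rw [← pow_mul]
      simp only [← pow_add]
      congr 1
      omega
    _ ≤ 2 ^ (2 * (k + s + s')) := pow_le_pow_right₀ one_le_two (by omega)
    _ = (2 ^ k * 2 ^ s * 2 ^ s') ^ 2 := by
      rw [← pow_add, ← pow_add, ← pow_mul, mul_comm]

/-- Every residue class modulo `p ^ 7` contains a sum of `136` positive seventh powers that is not
much larger than `p ^ 7`. -/
theorem exists_isRepr_modEq {k p : ℕ} (hk : 6000 ≤ k) (hp : p.Prime) (hkp : 2 ^ (9 * k) < p)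
    (hpk : p ≤ 2 ^ (9 * k + 1)) (n : ℕ) :
    ∃ S, IsRepr S 136 7 ∧ S ≤ 2 ^ 999 * p ^ 7 ∧ S ≡ n [MOD p ^ 7] := by
  obtain ⟨U, s, hUcard, hU, hs⟩ := exists_finset_isRepr 36 (56 * k) (by norm_num; omega)
  obtain ⟨V, s', hVcard, hV, hs'⟩ := exists_finset_isRepr 36 (63 * k) (by norm_num; omega)
  have hss : 182 * k + 20 ≤ k + s + 2 * s' := by
    norm_num at hs hs'
    omega
  have hM0 : 0 < p ^ 7 := pow_pos hp.pos 7
  have hkM : 2 ^ (63 * k) < p ^ 7 := by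
    rw [show 63 * k = 9 * k * 7 by ring, pow_mul]
    exact Nat.pow_lt_pow_left hkp (by norm_num)
  have hMk : p ^ 7 ≤ 2 ^ (63 * k + 7) := by
    rw [show 63 * k + 7 = (9 * k + 1) * 7 by ring, pow_mul]
    exact Nat.pow_le_pow_left hpk 7
  set P := 2 ^ 141 * p with hP
  have hP0 : 0 < P := Nat.mul_pos (by positivity) hp.pos
  set T := (Fintype.piFinset fun _ : Fin 28 => Finset.range P) ×ˢ
    ((Finset.range (2 ^ k) ×ˢ U) ×ˢ (V ×ˢ V)) with hT
  suffices h : ∃ t ∈ T, ∑ i, (P + t.1 i) ^ 7 +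
      ((t.2.1.1 + 1) ^ 7 * t.2.1.2 + (t.2.2.1 + t.2.2.2)) ≡ n [MOD p ^ 7] by
    obtain ⟨⟨y, ⟨x, u⟩, v, w⟩, ht, htn⟩ := h
    simp only [hT, Finset.mem_product, Fintype.mem_piFinset, Finset.mem_range] at ht
    obtain ⟨hy, ⟨hx, hu⟩, hv, hw⟩ := ht
    refine ⟨_, ?_, ?_, htn⟩
    · exact IsRepr.add (j := 108) ⟨fun i => P + y i, fun i => Nat.add_pos_left hP0 _, rfl⟩
        (IsRepr.add (j := 72) ((hU u hu).2.pow_mul (Nat.succ_pos x))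
          (IsRepr.add (hV v hv).2 (hV w hw).2))
    · have h1 : ∑ i, (P + y i) ^ 7 ≤ 28 * (2 ^ 994 * p ^ 7) := by
        calc ∑ i, (P + y i) ^ 7 ≤ ∑ _i : Fin 28, (2 ^ 142 * p) ^ 7 := by
              refine Finset.sum_le_sum fun i _ => Nat.pow_le_pow_left ?_ 7
              have := hy i
              rw [show 2 ^ 142 * p = P + P by rw [hP]; ring]
              omega
          _ = 28 * (2 ^ 994 * p ^ 7) := by
              rw [Finset.sum_const, Finset.card_univ, Fintype.card_fin, smul_eq_mul, mul_pow,
                ← pow_mul]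
      have h2 : (x + 1) ^ 7 * u ≤ p ^ 7 := by
        calc (x + 1) ^ 7 * u ≤ (2 ^ k) ^ 7 * 2 ^ (56 * k) :=
              Nat.mul_le_mul (Nat.pow_le_pow_left hx 7) (hU u hu).1
          _ = 2 ^ (63 * k) := by
              rw [← pow_mul, ← pow_add]
              congr 1
              omega
          _ ≤ p ^ 7 := hkM.le
      have h3 := (hV v hv).1.trans hkM.le
      have h4 := (hV w hw).1.trans hkM.le
      have h5 : 2 ^ 999 * p ^ 7 = 2 ^ 5 * (2 ^ 994 * p ^ 7) := by
        rw [show 999 = 5 + 994 by norm_num, pow_add, mul_assoc]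
      have h6 : p ^ 7 ≤ 2 ^ 994 * p ^ 7 := Nat.le_mul_of_pos_left _ (by positivity)
      rw [h5]
      generalize 2 ^ 994 * p ^ 7 = y at h1 h6 ⊢
      dsimp only
      omega
  by_contra! hno
  have h0 := sum_unitExp_mul_eq_zero (T := T) (F := fun t => ∑ i, (P + t.1 i) ^ 7 +
    ((t.2.1.1 + 1) ^ 7 * t.2.1.2 + (t.2.2.1 + t.2.2.2))) hM0 hno
  simp only [hT] at h0
  simp only [← circle_product_eq] at h0
  have hQ0 : 0 < 2 ^ (55 * k) := by positivity
  choose r hr hrQ using fun h : ℕ =>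
    Real.exists_rat_abs_sub_le_and_den_le ((h : ℝ) / (p ^ 7 : ℕ)) hQ0
  refine sum_range_ne_zero_of_arc_bounds hM0 (P := P) (A := 2 ^ k * 2 ^ s) (v := 2 ^ s')
    (Nat.cast_pos.2 hP0) (by positivity) (by positivity) (fun h => (r h).den ≤ 2 ^ (7 * k))
    (fun h => ?_) (fun h => ?_) (fun h => ?_) (fun h => norm_unitExp _) ?_ ?_ ?_ (fun h hh => ?_)
    ?_ ?_ h0
  · simpa using norm_sum_unitExp_le (Finset.range P) _
  · rw [← Finset.sum_product']
    refine (norm_sum_unitExp_le _ _).trans_eq ?_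
    rw [Finset.card_product, Finset.card_range, hUcard]
    push_cast
    rfl
  · refine (norm_sum_unitExp_le _ _).trans_eq ?_
    rw [hVcard]
    push_cast
    rfl
  · simp [unitExp_zero]
  · simp [unitExp_zero, hUcard]
  · simp [unitExp_zero, hVcard]
  · refine four_mul_norm_le_of_minor (norm_nonneg _) hUcard hMk (hrQ h) hss ?_
    refine normSq_sum_pow_seven_mul_le (Q := 2 ^ (55 * k)) ?_ (hr h) ?_ ?_
    · intro u hu
      exact Finset.mem_range.2 (Nat.lt_succ_of_le (hU u hu).1)
    · rw [← pow_mul, mul_comm]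
      exact not_le.1 hh
    · rw [← pow_mul, ← pow_succ']
      exact Nat.pow_le_pow_right two_pos (by omega)
  · refine (sum_norm_pow_le_of_den_le (K := 2 ^ (8 * k + 7)) (Q := 2 ^ (55 * k)) hp
      ((Nat.pow_le_pow_right two_pos (by omega)).trans_lt hkp) (by positivity)
      (major_arc_error_le hkp) ?_ r hr).trans ?_
    · refine hMk.trans ?_
      rw [mul_add, ← pow_add]
      refine le_trans (Nat.pow_le_pow_right two_pos (by omega)) (Nat.le_add_right _ _)
    · have h1 := mul_le_mul_of_nonneg_left (major_arc_numerics hk)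
        (by positivity : (0 : ℝ) ≤ (P : ℝ) ^ 28)
      rw [hP] at h1 ⊢
      generalize (2 ^ 481 : ℝ) ^ 4 = A at h1 ⊢
      generalize (2 ^ 867 / 2 ^ k : ℝ) = δ at h1 ⊢
      push_cast at h1 ⊢
      linarith
  · rw [sum_normSq_sum_unitExp fun v hv => (hV v hv).1.trans_lt hkM, hVcard]
    push_cast
    rfl

theorem isRepr_of_two_pow_le {l n : ℕ} (hl : 379007 ≤ l) (hn : 2 ^ l ≤ n) : IsRepr n 245 7 := by
  have hn0 : n ≠ 0 := (lt_of_lt_of_le (by positivity) hn).ne'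
  have hlog : l ≤ Nat.log 2 n := Nat.le_log_of_pow_le one_lt_two hn
  obtain ⟨k, hk, hk1, hk2⟩ : ∃ k, 6000 ≤ k ∧ 1007 + 63 * k ≤ Nat.log 2 n ∧
      Nat.log 2 n + 1 ≤ 1070 + 63 * k := ⟨(Nat.log 2 n - 1007) / 63, by omega, by omega, by omega⟩
  have h1 : 2 ^ (1007 + 63 * k) ≤ n :=
    (Nat.pow_le_pow_right two_pos hk1).trans (Nat.pow_log_le_self 2 hn0)
  have h2 : n ≤ 2 ^ (1070 + 63 * k) :=
    (Nat.lt_pow_succ_log_self one_lt_two n).le.trans (Nat.pow_le_pow_right two_pos hk2)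
  obtain ⟨p, hp, hkp, hpk⟩ := Nat.exists_prime_lt_and_le_two_mul (2 ^ (9 * k)) (by positivity)
  rw [← pow_succ'] at hpk
  obtain ⟨S, hS, hSle, hSn⟩ := exists_isRepr_modEq hk hp hkp hpk n
  have hkM : 2 ^ (63 * k) ≤ p ^ 7 := by
    rw [show 63 * k = 9 * k * 7 by ring, pow_mul]
    exact Nat.pow_le_pow_left hkp.le 7
  have hMk : 2 ^ 1000 * p ^ 7 ≤ 2 ^ (1007 + 63 * k) := by
    calc 2 ^ 1000 * p ^ 7 ≤ 2 ^ 1000 * (2 ^ (9 * k + 1)) ^ 7 :=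
          Nat.mul_le_mul_left _ (Nat.pow_le_pow_left hpk 7)
      _ = 2 ^ (1007 + 63 * k) := by
          rw [← pow_mul, ← pow_add]
          exact congrArg _ (by omega)
  have h3 : 2 ^ 1000 * p ^ 7 = 2 ^ 999 * p ^ 7 + 2 ^ 999 * p ^ 7 := by
    rw [show 1000 = 999 + 1 by norm_num, pow_succ, mul_right_comm, mul_two]
  have hSn' : S ≤ n := by omega
  obtain ⟨c, hc⟩ := (Nat.modEq_iff_dvd' hSn').1 hSn
  have hp7 : 0 < p ^ 7 := pow_pos hp.pos 7
  have hc1 : 2 ^ 999 ≤ c := by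
    refine Nat.le_of_mul_le_mul_left ?_ hp7
    rw [← hc, mul_comm]
    omega
  have hc2 : c ≤ 2 ^ 1070 := by
    refine Nat.le_of_mul_le_mul_left ?_ hp7
    rw [← hc]
    calc n - S ≤ 2 ^ (63 * k) * 2 ^ 1070 := by
          rw [← pow_add, add_comm]
          exact (Nat.sub_le _ _).trans h2
      _ ≤ p ^ 7 * 2 ^ 1070 := Nat.mul_le_mul_right _ hkM
  have h4 : 2 ^ 30 ≤ 2 ^ 999 := Nat.pow_le_pow_right two_pos (show 30 ≤ 999 by norm_num)
  have h5 : 2 ^ 1070 ≤ 2 ^ 1071 := Nat.pow_le_pow_right two_pos (by norm_num)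
  have hc109 : IsRepr c 109 7 := by
    have h6 : 2 ^ 30 ≤ c := h4.trans hc1
    have h7 : c ≤ 2 ^ 1071 := hc2.trans h5
    clear hc1 hc2 h4 h5
    have h8 := reachInterval_109 (c - 109)
    generalize 2 ^ 1071 = y at h7 h8
    have h9 := h8 (by omega) (by omega)
    rwa [Reach, Nat.sub_add_cancel (by omega)] at h9
  have := hS.add (hc109.pow_mul hp.pos)
  rwa [← hc, Nat.add_sub_cancel' hSn'] at this

/-- for every `j ≥ 245` and every positive integer `m`, `m + j` is the
sum of exactly `j` positive seventh powers iff `m + 245` is the sum of exactly `245`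
positive seventh powers. -/
theorem stmt_18 :
    ∀ j : ℕ, 245 ≤ j → ∀ m : ℕ, 0 < m →
      (IsRepr (m + j) j 7 ↔ IsRepr (m + 245) 245 7) := by
  intro j hj m _
  refine ⟨fun h => ?_, fun h => Reach.mono h hj⟩
  rcases lt_or_ge m 1900000 with hm | hm
  · exact reach_of_testBit_smallBits m (testBit_smallBits_of_reach h hm)
  · obtain ⟨e, he, hI⟩ := reachInterval_245
    rcases le_or_gt m (1872394 + 2 ^ e) with hme | hme
    · exact hI m (by omega) hme
    · exact isRepr_of_two_pow_le (l := e) (by omega) (by omega)
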